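/- arXiv:1301.0927 — 9 statements merged into one kernel-verified Lean document; each statement's English description precedes it below -/
import Mathlib

section
/- There exists a sequence of smooth compactly supported functions Φ_k : ℝ⁴ → ℝ, positive radii r_k and R_k with R_k → 0 as k → ∞, such that for every k: 0 ≤ Φ_k ≤ 1 everywhere, Φ_k ≡ 1 on the closed ball of radius r_k centered at 0, the support of Φ_k is contained in the closed ball of radius R_k centered at 0, and moreover the squared W^{2,2}-norm tends to zero: ∫_{ℝ⁴} ( |Φ_k(x)|² + ‖fderiv ℝ Φ_k x‖² + ‖iteratedFDeriv ℝ 2 Φ_k x‖² ) dx → 0 as k → ∞. -/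
open MeasureTheory Filter Metric

theorem norm_sum_sq_le_of_pairwise_eq_zero {ι F : Type*} [SeminormedAddCommGroup F]
    (s : Finset ι) (f : ι → F) (h : ∀ i ∈ s, ∀ j ∈ s, i ≠ j → f i = 0 ∨ f j = 0) :
    ‖∑ i ∈ s, f i‖ ^ 2 ≤ ∑ i ∈ s, ‖f i‖ ^ 2 := by
  by_cases h0 : ∀ i ∈ s, f i = 0
  · rw [Finset.sum_eq_zero h0, norm_zero, zero_pow two_ne_zero]
    positivity
  · push Not at h0
    obtain ⟨i, hi, hfi⟩ := h0
    rw [Finset.sum_eq_single_of_mem i hi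
      fun j hj hji => (h i hi j hj hji.symm).resolve_left hfi]
    exact Finset.single_le_sum (f := fun i => ‖f i‖ ^ 2) (fun j _ => by positivity) hi

theorem tendsto_const_div_natCast_add_one (C : ℝ) :
    Tendsto (fun N : ℕ => C / ((N : ℝ) + 1)) atTop (nhds 0) := by
  simpa [div_eq_mul_inv] using
    (tendsto_one_div_add_atTop_nhds_zero_nat (𝕜 := ℝ)).const_mul C

theorem integrable_norm_iteratedFDeriv_sq {E : Type*} [NormedAddCommGroup E] [NormedSpace ℝ E]
    [MeasurableSpace E] [BorelSpace E] {f : E → ℝ} {n : ℕ} (hf : ContDiff ℝ n f)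
    (hs : HasCompactSupport f) (μ : Measure E) [IsFiniteMeasureOnCompacts μ] :
    Integrable (fun x => ‖iteratedFDeriv ℝ n f x‖ ^ 2) μ := by
  have hc : Continuous fun x => ‖iteratedFDeriv ℝ n f x‖ ^ 2 :=
    (hf.continuous_iteratedFDeriv le_rfl).norm.pow 2
  refine hc.integrable_of_hasCompactSupport ?_
  refine HasCompactSupport.mono (hs.iteratedFDeriv (𝕜 := ℝ) n) fun x hx => ?_
  simpa using hx

namespace ContDiffBump

variable {E : Type*} [NormedAddCommGroup E] [InnerProductSpace ℝ E]

theorem iteratedFDeriv_eq_zero {c : E} (φ : ContDiffBump c) {n : ℕ}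
    (hn : n ≠ 0) {x : E} (hx : dist x c < φ.rIn ∨ φ.rOut < dist x c) :
    iteratedFDeriv ℝ n φ x = 0 := by
  rcases hx with hx | hx
  · rw [((φ.eventuallyEq_one_of_mem_ball hx).iteratedFDeriv ℝ n).eq_of_nhds]
    exact congrFun (iteratedFDeriv_const_of_ne hn (1 : ℝ)) x
  · by_contra h
    have := support_iteratedFDeriv_subset n (Function.mem_support.2 h)
    rw [φ.tsupport_eq, mem_closedBall] at this
    linarith

variable [FiniteDimensional ℝ E] (φ : ContDiffBump (0 : E))

theorem iteratedFDeriv_comp_smul (n : ℕ) (c : ℝ) (x : E) :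
    iteratedFDeriv ℝ n (fun y => φ (c • y)) x = c ^ n • iteratedFDeriv ℝ n φ (c • x) :=
  congrFun (iteratedFDeriv_comp_const_smul c φ.contDiff) x

/-- The mean of the dilates `x ↦ φ (4 ^ (N + j) • x)` for `j ≤ N`. -/
noncomputable def dilateMean (N : ℕ) (x : E) : ℝ :=
  ((N : ℝ) + 1)⁻¹ * ∑ j ∈ Finset.range (N + 1), φ ((4 : ℝ) ^ (N + j) • x)

theorem contDiff_dilateMean (N : ℕ) {n : ℕ∞} : ContDiff ℝ n (φ.dilateMean N) :=
  contDiff_const.mul <| ContDiff.sum fun _ _ => φ.contDiff.comp (contDiff_const_smul _)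

theorem dilateMean_nonneg (N : ℕ) (x : E) : 0 ≤ φ.dilateMean N x :=
  mul_nonneg (by positivity) (Finset.sum_nonneg fun _ _ => φ.nonneg)

theorem dilateMean_le_one (N : ℕ) (x : E) : φ.dilateMean N x ≤ 1 := by
  rw [dilateMean, inv_mul_le_iff₀ (by positivity), mul_one]
  refine (Finset.sum_le_card_nsmul _ _ 1 fun _ _ => φ.le_one).trans ?_
  simp

theorem dilateMean_eq_one (N : ℕ) {x : E} (hx : ‖x‖ ≤ φ.rIn / 4 ^ (2 * N)) :
    φ.dilateMean N x = 1 := by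
  have h : ∀ j ∈ Finset.range (N + 1), φ ((4 : ℝ) ^ (N + j) • x) = 1 := fun j hj => by
    apply φ.one_of_mem_closedBall
    rw [Finset.mem_range] at hj
    rw [mem_closedBall_zero_iff, norm_smul, norm_pow, Real.norm_ofNat]
    rw [le_div_iff₀' (by positivity)] at hx
    refine le_trans ?_ hx
    gcongr
    · norm_num
    · omega
  rw [dilateMean, Finset.sum_congr rfl h]
  simp
  field_simp

theorem support_dilateMean_subset (N : ℕ) :
    Function.support (φ.dilateMean N) ⊆ closedBall 0 (φ.rOut / 4 ^ N) := by
  intro x hx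
  by_contra hx'
  refine hx ?_
  rw [mem_closedBall_zero_iff, not_le, div_lt_iff₀' (by positivity)] at hx'
  rw [dilateMean, Finset.sum_eq_zero, mul_zero]
  intro j _
  apply φ.zero_of_le_dist
  rw [dist_zero_right, norm_smul, norm_pow, Real.norm_ofNat]
  refine hx'.le.trans ?_
  gcongr
  · norm_num
  · omega

theorem hasCompactSupport_dilateMean (N : ℕ) : HasCompactSupport (φ.dilateMean N) :=
  HasCompactSupport.intro (isCompact_closedBall 0 (φ.rOut / 4 ^ N)) fun x hx => by
    by_contra h
    exact hx (φ.support_dilateMean_subset N h)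

theorem iteratedFDeriv_dilateMean (n N : ℕ) (x : E) :
    iteratedFDeriv ℝ n (φ.dilateMean N) x =
      ((N : ℝ) + 1)⁻¹ • ∑ j ∈ Finset.range (N + 1),
        iteratedFDeriv ℝ n (fun y => φ ((4 : ℝ) ^ (N + j) • y)) x := by
  have h : ∀ j : ℕ, ContDiff ℝ n fun y : E => φ ((4 : ℝ) ^ (N + j) • y) :=
    fun j => φ.contDiff.comp (contDiff_const_smul _)
  rw [← iteratedFDeriv_fun_sum_apply fun j _ => (h j).contDiffAt,
    ← iteratedFDeriv_const_smul_apply (ContDiff.sum fun j _ => h j).contDiffAt]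
  rfl

/-- The positive-order derivatives of the dilates have disjoint supports. -/
theorem norm_iteratedFDeriv_dilateMean_sq_le (hφ : φ.rOut < 4 * φ.rIn) {n : ℕ} (hn : n ≠ 0)
    (N : ℕ) (x : E) :
    ‖iteratedFDeriv ℝ n (φ.dilateMean N) x‖ ^ 2 ≤
      (((N : ℝ) + 1) ^ 2)⁻¹ * ∑ j ∈ Finset.range (N + 1),
        ‖iteratedFDeriv ℝ n (fun y => φ ((4 : ℝ) ^ (N + j) • y)) x‖ ^ 2 := by
  rw [iteratedFDeriv_dilateMean, norm_smul, mul_pow, norm_inv, inv_pow,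
    Real.norm_of_nonneg (by positivity)]
  refine mul_le_mul_of_nonneg_left (norm_sum_sq_le_of_pairwise_eq_zero _ _ ?_) (by positivity)
  have key : ∀ i j : ℕ, i < j →
      iteratedFDeriv ℝ n (fun y => φ ((4 : ℝ) ^ (N + i) • y)) x = 0 ∨
      iteratedFDeriv ℝ n (fun y => φ ((4 : ℝ) ^ (N + j) • y)) x = 0 := by
    intro i j hij
    simp only [iteratedFDeriv_comp_smul]
    rcases lt_or_ge ‖(4 : ℝ) ^ (N + i) • x‖ φ.rIn with h | h
    · left
      rw [φ.iteratedFDeriv_eq_zero hn (Or.inl (by rwa [dist_zero_right])), smul_zero]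
    · right
      rw [φ.iteratedFDeriv_eq_zero hn (Or.inr ?_), smul_zero]
      rw [norm_smul, norm_pow, Real.norm_ofNat] at h
      rw [dist_zero_right, norm_smul, norm_pow, Real.norm_ofNat]
      calc φ.rOut < 4 * φ.rIn := hφ
        _ ≤ 4 * (4 ^ (N + i) * ‖x‖) := by gcongr
        _ = 4 ^ (N + i + 1) * ‖x‖ := by ring
        _ ≤ 4 ^ (N + j) * ‖x‖ := mul_le_mul_of_nonneg_right
          (pow_le_pow_right₀ (by norm_num) (by omega)) (norm_nonneg x)
  intro i _ j _ hij
  rcases lt_or_gt_of_ne hij with h | h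
  · exact key i j h
  · exact (key j i h).symm

variable [MeasurableSpace E] [BorelSpace E] (μ : Measure E) [μ.IsAddHaarMeasure]

theorem integrable_norm_iteratedFDeriv_comp_smul_sq (n : ℕ) {c : ℝ} (hc : c ≠ 0) :
    Integrable (fun x => ‖iteratedFDeriv ℝ n (fun y => φ (c • y)) x‖ ^ 2) μ := by
  have hd : ContDiff ℝ n fun y : E => φ (c • y) := φ.contDiff.comp (contDiff_const_smul c)
  have hs : HasCompactSupport fun y : E => φ (c • y) := φ.hasCompactSupport.comp_smul hc
  exact integrable_norm_iteratedFDeriv_sq hd hs μ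

theorem integral_norm_iteratedFDeriv_comp_smul_sq (n : ℕ) {c : ℝ} (hc : 0 ≤ c) :
    ∫ x, ‖iteratedFDeriv ℝ n (fun y => φ (c • y)) x‖ ^ 2 ∂μ =
      c ^ (2 * n) * (c ^ Module.finrank ℝ E)⁻¹ * ∫ x, ‖iteratedFDeriv ℝ n φ x‖ ^ 2 ∂μ := by
  simp only [iteratedFDeriv_comp_smul, norm_smul, mul_pow, norm_pow, Real.norm_of_nonneg hc]
  rw [integral_const_mul,
    Measure.integral_comp_smul_of_nonneg μ (fun x => ‖iteratedFDeriv ℝ n φ x‖ ^ 2) c (hR := hc),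
    smul_eq_mul]
  ring

theorem integral_norm_iteratedFDeriv_dilateMean_sq_le (hφ : φ.rOut < 4 * φ.rIn) {n : ℕ}
    (hn : n ≠ 0) (hnE : 2 * n ≤ Module.finrank ℝ E) (N : ℕ) :
    ∫ x, ‖iteratedFDeriv ℝ n (φ.dilateMean N) x‖ ^ 2 ∂μ ≤
      (∫ x, ‖iteratedFDeriv ℝ n φ x‖ ^ 2 ∂μ) / (N + 1) := by
  have hint : ∀ j ∈ Finset.range (N + 1), Integrable
      (fun x => ‖iteratedFDeriv ℝ n (fun y => φ ((4 : ℝ) ^ (N + j) • y)) x‖ ^ 2) μ :=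
    fun j _ => φ.integrable_norm_iteratedFDeriv_comp_smul_sq μ n (by positivity)
  have hI : 0 ≤ ∫ x, ‖iteratedFDeriv ℝ n φ x‖ ^ 2 ∂μ := integral_nonneg fun _ => by positivity
  calc ∫ x, ‖iteratedFDeriv ℝ n (φ.dilateMean N) x‖ ^ 2 ∂μ
      ≤ ∫ x, (((N : ℝ) + 1) ^ 2)⁻¹ * ∑ j ∈ Finset.range (N + 1),
          ‖iteratedFDeriv ℝ n (fun y => φ ((4 : ℝ) ^ (N + j) • y)) x‖ ^ 2 ∂μ :=
        integral_mono
          (integrable_norm_iteratedFDeriv_sq (φ.contDiff_dilateMean N)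
            (φ.hasCompactSupport_dilateMean N) μ)
          ((integrable_finsetSum _ hint).const_mul _)
          (φ.norm_iteratedFDeriv_dilateMean_sq_le hφ hn N)
    _ = (((N : ℝ) + 1) ^ 2)⁻¹ * ∑ j ∈ Finset.range (N + 1),
          ∫ x, ‖iteratedFDeriv ℝ n (fun y => φ ((4 : ℝ) ^ (N + j) • y)) x‖ ^ 2 ∂μ := by
        rw [integral_const_mul, integral_finsetSum _ hint]
    _ ≤ (((N : ℝ) + 1) ^ 2)⁻¹ * ∑ j ∈ Finset.range (N + 1),
          ∫ x, ‖iteratedFDeriv ℝ n φ x‖ ^ 2 ∂μ := by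
        refine mul_le_mul_of_nonneg_left (Finset.sum_le_sum fun j _ => ?_) (by positivity)
        rw [integral_norm_iteratedFDeriv_comp_smul_sq φ μ n (by positivity)]
        refine mul_le_of_le_one_left hI ?_
        rw [← div_eq_mul_inv, div_le_one₀ (by positivity)]
        exact pow_le_pow_right₀ (one_le_pow₀ (by norm_num)) hnE
    _ = (∫ x, ‖iteratedFDeriv ℝ n φ x‖ ^ 2 ∂μ) / (N + 1) := by
        rw [Finset.sum_const, Finset.card_range, nsmul_eq_mul]
        push_cast
        field_simp

theorem tendsto_integral_norm_iteratedFDeriv_dilateMean_sq (hφ : φ.rOut < 4 * φ.rIn) {n : ℕ}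
    (hn : n ≠ 0) (hnE : 2 * n ≤ Module.finrank ℝ E) :
    Tendsto (fun N => ∫ x, ‖iteratedFDeriv ℝ n (φ.dilateMean N) x‖ ^ 2 ∂μ) atTop (nhds 0) :=
  squeeze_zero (fun _ => integral_nonneg fun _ => by positivity)
    (φ.integral_norm_iteratedFDeriv_dilateMean_sq_le μ hφ hn hnE)
    (tendsto_const_div_natCast_add_one _)

theorem tendsto_integral_dilateMean_sq [Nontrivial E] :
    Tendsto (fun N => ∫ x, |φ.dilateMean N x| ^ 2 ∂μ) atTop (nhds 0) := by
  have hR : Tendsto (fun N : ℕ => φ.rOut / 4 ^ N) atTop (nhds 0) :=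
    tendsto_const_nhds.div_atTop (tendsto_pow_atTop_atTop_of_one_lt (by norm_num))
  have hlim := (hR.pow (Module.finrank ℝ E)).mul_const (μ.real (ball 0 1))
  rw [zero_pow Module.finrank_pos.ne', zero_mul] at hlim
  refine squeeze_zero (fun _ => integral_nonneg fun _ => by positivity) (fun N => ?_) hlim
  rw [← Measure.addHaar_real_closedBall μ 0 (div_nonneg φ.rOut_pos.le (by positivity)),
    ← integral_indicator_one measurableSet_closedBall]
  refine integral_mono_of_nonneg (ae_of_all _ fun _ => by positivity)
    ((integrable_indicator_iff measurableSet_closedBall).2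
      (integrableOn_const measure_closedBall_lt_top.ne)) (ae_of_all _ fun x => ?_)
  by_cases hx : x ∈ closedBall 0 (φ.rOut / 4 ^ N)
  · rw [Set.indicator_of_mem hx]
    exact pow_le_one₀ (abs_nonneg _)
      (by rw [abs_of_nonneg (φ.dilateMean_nonneg N x)]; exact φ.dilateMean_le_one N x)
  · have h0 : φ.dilateMean N x = 0 := by
      by_contra h
      exact hx (φ.support_dilateMean_subset N h)
    simp [h0, Set.indicator_of_notMem hx]

end ContDiffBump

/-- Lemma 3.2: points have zero `W^{2,2}`-capacity in dimension 4. There is a sequence of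
smooth compactly supported cutoff functions, equal to `1` near the origin, supported in
shrinking balls, whose `W^{2,2}` norms tend to zero. -/
theorem stmt_0 :
    ∃ (Φ : ℕ → EuclideanSpace ℝ (Fin 4) → ℝ) (r R : ℕ → ℝ),
      (∀ k, 0 < r k) ∧ (∀ k, 0 < R k) ∧
      Tendsto R atTop (nhds 0) ∧
      (∀ k, ContDiff ℝ (⊤ : ℕ∞) (Φ k)) ∧
      (∀ k, HasCompactSupport (Φ k)) ∧
      (∀ k x, 0 ≤ Φ k x) ∧ (∀ k x, Φ k x ≤ 1) ∧
      (∀ k, ∀ x ∈ closedBall (0 : EuclideanSpace ℝ (Fin 4)) (r k), Φ k x = 1) ∧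
      (∀ k, Function.support (Φ k) ⊆ closedBall (0 : EuclideanSpace ℝ (Fin 4)) (R k)) ∧
      Tendsto (fun k => ∫ x : EuclideanSpace ℝ (Fin 4),
          (|Φ k x| ^ 2 + ‖fderiv ℝ (Φ k) x‖ ^ 2 + ‖iteratedFDeriv ℝ 2 (Φ k) x‖ ^ 2))
        atTop (nhds 0) := by
  let φ : ContDiffBump (0 : EuclideanSpace ℝ (Fin 4)) := ⟨1, 2, one_pos, one_lt_two⟩
  have hφ : φ.rOut < 4 * φ.rIn := by norm_num [φ]
  have hint (n k : ℕ) : Integrable fun x => ‖iteratedFDeriv ℝ n (φ.dilateMean k) x‖ ^ 2 :=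
    integrable_norm_iteratedFDeriv_sq (φ.contDiff_dilateMean k)
      (φ.hasCompactSupport_dilateMean k) volume
  refine ⟨φ.dilateMean, fun k => φ.rIn / 4 ^ (2 * k), fun k => φ.rOut / 4 ^ k,
    fun k => div_pos φ.rIn_pos (by positivity), fun k => div_pos φ.rOut_pos (by positivity),
    tendsto_const_nhds.div_atTop (tendsto_pow_atTop_atTop_of_one_lt (by norm_num)),
    fun k => φ.contDiff_dilateMean k, φ.hasCompactSupport_dilateMean, φ.dilateMean_nonneg,
    φ.dilateMean_le_one, fun k x hx => φ.dilateMean_eq_one k (mem_closedBall_zero_iff.1 hx),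
    φ.support_dilateMean_subset, ?_⟩
  have hlim := ((φ.tendsto_integral_dilateMean_sq volume).add
    (φ.tendsto_integral_norm_iteratedFDeriv_dilateMean_sq volume hφ (n := 1) (by norm_num)
      (by simp))).add
    (φ.tendsto_integral_norm_iteratedFDeriv_dilateMean_sq volume hφ (n := 2) (by norm_num)
      (by simp))
  rw [add_zero, add_zero] at hlim
  refine hlim.congr fun k => ?_
  have h0 : Integrable fun x => |φ.dilateMean k x| ^ 2 := by simpa using hint 0 k
  simp only [← norm_iteratedFDeriv_one]
  rw [← integral_add h0 (hint 1 k)]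
  exact (integral_add (h0.add (hint 1 k)) (hint 2 k)).symm
end

section
/- The function f belongs to W^{2,2}(B⁴) in the following sense: f is C^∞ on B⁴ \ {0}, and both ∫_{B⁴} |f(x)|² dx < ∞ and ∫_{B⁴} ‖iteratedFDeriv ℝ 2 f x‖² dx < ∞ (the latter integral taken over B⁴ \ {0}, a set of full measure). -/
open MeasureTheory Metric

/-- `φ(t) = log (log (e − log t))`. Note `Real.log 0 = 0`, so `φ 0 = 0`. -/
noncomputable def φ (t : ℝ) : ℝ := Real.log (Real.log (Real.exp 1 - Real.log t))

/-- `f(x) = φ(‖x‖)`; since `φ 0 = 0` this gives `f 0 = 0` as well. -/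
noncomputable def f (x : EuclideanSpace ℝ (Fin 4)) : ℝ := φ ‖x‖

lemma one_le_log_exp_one_sub_log {t : ℝ} (ht : 0 ≤ t) (ht1 : t ≤ 1) :
    1 ≤ Real.log (Real.exp 1 - Real.log t) := by
  have h : Real.exp 1 ≤ Real.exp 1 - Real.log t := by
    linarith [Real.log_nonpos ht ht1]
  simpa using Real.log_le_log (Real.exp_pos 1) h

lemma one_le_exp_one_sub_log {t : ℝ} (ht : 0 ≤ t) (ht1 : t ≤ 1) :
    1 ≤ Real.exp 1 - Real.log t := by
  linarith [Real.log_nonpos ht ht1, Real.add_one_le_exp 1]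

lemma φ_nonneg {t : ℝ} (ht : 0 ≤ t) (ht1 : t ≤ 1) : 0 ≤ φ t :=
  Real.log_nonneg (one_le_log_exp_one_sub_log ht ht1)

lemma φ_le {t : ℝ} (ht : 0 < t) (ht1 : t ≤ 1) : φ t ≤ Real.exp 1 + t⁻¹ := by
  have h1 := one_le_log_exp_one_sub_log ht.le ht1
  have h2 := one_le_exp_one_sub_log ht.le ht1
  have h3 := Real.log_le_self (zero_le_one.trans h1)
  have h4 := Real.log_le_self (zero_le_one.trans h2)
  have h5 := Real.log_le_self (inv_pos.2 ht).le
  rw [Real.log_inv] at h5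
  unfold φ
  linarith

lemma measurable_φ : Measurable φ := by
  unfold φ
  fun_prop

lemma contDiffAt_f {x : EuclideanSpace ℝ (Fin 4)} (hx : x ≠ 0) (hx1 : ‖x‖ < 1) :
    ContDiffAt ℝ (⊤ : ℕ∞) f x := by
  have h1 := one_le_log_exp_one_sub_log (norm_nonneg x) hx1.le
  have h2 := one_le_exp_one_sub_log (norm_nonneg x) hx1.le
  have hn : ContDiffAt ℝ (⊤ : ℕ∞) (fun y : EuclideanSpace ℝ (Fin 4) => ‖y‖) x :=
    contDiffAt_norm ℝ hx
  exact ((contDiffAt_const.sub (hn.log (norm_ne_zero_iff.2 hx))).log (by positivity)).log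
    (by positivity)

/-- The function `h` with `D f (x) = h (‖x‖ ^ 2) ⟪x, ·⟫`. -/
noncomputable def radialFactor (u : ℝ) : ℝ :=
  -(u * (Real.exp 1 - Real.log u / 2) * Real.log (Real.exp 1 - Real.log u / 2))⁻¹

lemma hasDerivAt_radialFactor {u : ℝ} (hu : 0 < u) (hu1 : u < 1) :
    HasDerivAt radialFactor
      (((Real.exp 1 - Real.log u / 2 - 1 / 2) * Real.log (Real.exp 1 - Real.log u / 2) - 1 / 2) /
        (u * (Real.exp 1 - Real.log u / 2) * Real.log (Real.exp 1 - Real.log u / 2)) ^ 2) u := by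
  have hs : Real.log u / 2 = Real.log √u := (Real.log_sqrt hu.le).symm
  have h1 := one_le_log_exp_one_sub_log (Real.sqrt_nonneg u) (Real.sqrt_le_one.2 hu1.le)
  have h2 := one_le_exp_one_sub_log (Real.sqrt_nonneg u) (Real.sqrt_le_one.2 hu1.le)
  rw [← hs] at h1 h2
  have hL : HasDerivAt (fun u => Real.exp 1 - Real.log u / 2) (-(u⁻¹ / 2)) u := by
    simpa using ((Real.hasDerivAt_log hu.ne').div_const 2).const_sub (Real.exp 1)
  have hne : Real.exp 1 - Real.log u / 2 ≠ 0 := by positivity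
  have hne' : Real.log (Real.exp 1 - Real.log u / 2) ≠ 0 := by positivity
  have := ((((hasDerivAt_id u).mul hL).mul (hL.log hne)).inv
    (mul_ne_zero (mul_ne_zero hu.ne' hne) hne')).neg
  refine this.congr_deriv ?_
  simp only [id, Pi.mul_apply]
  generalize Real.log (Real.exp 1 - Real.log u / 2) = M at *
  generalize Real.exp 1 - Real.log u / 2 = L at *
  field_simp
  ring

lemma hasFDerivAt_f {x : EuclideanSpace ℝ (Fin 4)} (hx : x ≠ 0) (hx1 : ‖x‖ < 1) :
    HasFDerivAt f (radialFactor (‖x‖ ^ 2) • innerSL ℝ x) x := by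
  have h1 := one_le_log_exp_one_sub_log (norm_nonneg x) hx1.le
  have h2 := one_le_exp_one_sub_log (norm_nonneg x) hx1.le
  have hx0 : ‖x‖ ≠ 0 := norm_ne_zero_iff.2 hx
  have hlog : ∀ y : EuclideanSpace ℝ (Fin 4), Real.log ‖y‖ = Real.log (‖y‖ ^ 2) / 2 := by
    intro y
    rw [Real.log_pow]
    push_cast
    ring
  have hf : f = fun y => Real.log (Real.log (Real.exp 1 - Real.log (‖y‖ ^ 2) / 2)) := by
    funext y
    simp only [f, φ, hlog]
  rw [hlog] at h1 h2
  have hn := (hasStrictFDerivAt_norm_sq x).hasFDerivAt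
  have hL : HasDerivAt (fun u => Real.exp 1 - Real.log u / 2) (-((‖x‖ ^ 2)⁻¹ / 2)) (‖x‖ ^ 2) := by
    simpa using ((Real.hasDerivAt_log (pow_ne_zero 2 hx0)).div_const 2).const_sub (Real.exp 1)
  have hne : Real.exp 1 - Real.log (‖x‖ ^ 2) / 2 ≠ 0 := by positivity
  have hne' : Real.log (Real.exp 1 - Real.log (‖x‖ ^ 2) / 2) ≠ 0 := by positivity
  have := ((hL.log hne).log hne').comp_hasFDerivAt x hn
  rw [hf]
  refine this.congr_fderiv ?_
  rw [← Nat.cast_smul_eq_nsmul ℝ, smul_smul]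
  congr 1
  unfold radialFactor
  push_cast
  field_simp

lemma norm_iteratedFDeriv_two_f_le {x : EuclideanSpace ℝ (Fin 4)} (hx : x ≠ 0) (hx1 : ‖x‖ < 1) :
    ‖iteratedFDeriv ℝ 2 f x‖ ≤ 3 / (‖x‖ ^ 2 * (Real.exp 1 - Real.log ‖x‖)) := by
  have h1 := one_le_log_exp_one_sub_log (norm_nonneg x) hx1.le
  have h2 := one_le_exp_one_sub_log (norm_nonneg x) hx1.le
  have hx0 : 0 < ‖x‖ := norm_pos_iff.2 hx
  have hlog : Real.log (‖x‖ ^ 2) / 2 = Real.log ‖x‖ := by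
    rw [Real.log_pow]
    push_cast
    ring
  have hev : fderiv ℝ f =ᶠ[nhds x] fun y => radialFactor (‖y‖ ^ 2) • innerSL ℝ y := by
    filter_upwards [isOpen_ne.mem_nhds hx, isOpen_ball.mem_nhds (mem_ball_zero_iff.2 hx1)]
      with y hy hy1
    exact (hasFDerivAt_f hy (mem_ball_zero_iff.1 hy1)).fderiv
  have hu1 : ‖x‖ ^ 2 < 1 := pow_lt_one₀ hx0.le hx1 two_ne_zero
  have hd := (hasDerivAt_radialFactor (pow_pos hx0 2) hu1).comp_hasFDerivAt x
    (hasStrictFDerivAt_norm_sq x).hasFDerivAt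
  have hD := (hd.smul (innerSL ℝ (E := EuclideanSpace ℝ (Fin 4))).hasFDerivAt).congr_of_eventuallyEq
    hev
  rw [← norm_iteratedFDeriv_fderiv, norm_iteratedFDeriv_one, hD.fderiv]
  simp only [hlog, Function.comp]
  have hr : ‖radialFactor (‖x‖ ^ 2)‖ ≤ 1 / (‖x‖ ^ 2 * (Real.exp 1 - Real.log ‖x‖)) := by
    rw [radialFactor, hlog, norm_neg, Real.norm_of_nonneg (by positivity), ← one_div]
    exact one_div_le_one_div_of_le (by positivity) (le_mul_of_one_le_right (by positivity) h1)
  set L := Real.exp 1 - Real.log ‖x‖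
  set M := Real.log L
  have hnum : 0 ≤ (L - 1 / 2) * M - 1 / 2 := by nlinarith
  have hr' : ‖((L - 1 / 2) * M - 1 / 2) / (‖x‖ ^ 2 * L * M) ^ 2‖ ≤ 1 / (‖x‖ ^ 4 * L) := by
    rw [Real.norm_of_nonneg (by positivity), div_le_div_iff₀ (by positivity) (by positivity)]
    have : ((L - 1 / 2) * M - 1 / 2) * L ≤ L * M * L * M := by
      nlinarith [mul_nonneg (sub_nonneg.2 h1) (sub_nonneg.2 h2), mul_pos (zero_lt_one.trans_le h1)
        (zero_lt_one.trans_le h2)]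
    calc _ = ‖x‖ ^ 4 * (((L - 1 / 2) * M - 1 / 2) * L) := by ring
      _ ≤ ‖x‖ ^ 4 * (L * M * L * M) := by gcongr
      _ = _ := by ring
  refine (norm_add_le _ _).trans ?_
  rw [ContinuousLinearMap.norm_smulRight_apply, norm_smul, norm_smul, innerSL_apply_norm,
    ← Nat.cast_smul_eq_nsmul ℝ, norm_smul, innerSL_apply_norm]
  calc _ ≤ 1 / (‖x‖ ^ 2 * L) * 1 + 1 / (‖x‖ ^ 4 * L) * (‖((2 : ℕ) : ℝ)‖ * ‖x‖) * ‖x‖ := by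
        gcongr
        exact norm_innerSL_le ℝ
    _ = _ := by
        rw [Nat.cast_ofNat, Real.norm_ofNat]
        field_simp
        norm_num

lemma integrableOn_inv_div_sq :
    IntegrableOn (fun t : ℝ => t⁻¹ / (Real.exp 1 - Real.log t) ^ 2) (Set.Ioc 0 1) := by
  have hderiv : ∀ t ∈ Set.Ioc (0 : ℝ) 1, HasDerivAt (fun t => (Real.exp 1 - Real.log t)⁻¹)
      (t⁻¹ / (Real.exp 1 - Real.log t) ^ 2) t := by
    intro t ht
    have h2 := one_le_exp_one_sub_log ht.1.le ht.2
    have := ((Real.hasDerivAt_log ht.1.ne').const_sub (Real.exp 1)).inv (by positivity)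
    exact this.congr_deriv (by simp)
  have hsub : Set.Icc (0 : ℝ) 1 \ {0} ⊆ Set.Ioc 0 1 :=
    fun t ht => ⟨lt_of_le_of_ne ht.1.1 (Ne.symm ht.2), ht.1.2⟩
  refine intervalIntegral.integrableOn_deriv_of_nonneg
    (g := Function.update (fun t => (Real.exp 1 - Real.log t)⁻¹) 0 0) ?_ ?_ ?_
  · refine continuousOn_update_iff.2
      ⟨fun t ht => (hderiv t (hsub ht)).continuousAt.continuousWithinAt, fun _ => ?_⟩
    refine Filter.Tendsto.inv_tendsto_atTop ?_
    have : Filter.Tendsto (fun t => Real.exp 1 - Real.log t) (nhdsWithin 0 (Set.Ioi 0))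
        Filter.atTop := by
      simp only [sub_eq_add_neg]
      exact Filter.tendsto_atTop_add_const_left _ _
        (Filter.tendsto_neg_atBot_atTop.comp Real.tendsto_log_nhdsGT_zero)
    exact this.mono_left (nhdsWithin_mono _ fun t ht => (hsub ht).1)
  · intro t ht
    refine (hderiv t ⟨ht.1, ht.2.le⟩).congr_of_eventuallyEq ?_
    filter_upwards [isOpen_ne.mem_nhds ht.1.ne'] with s hs
    exact Function.update_of_ne hs _ _
  · intro t ht
    have := ht.1
    positivity

/-- Lemma 4.1: `f ∈ W^{2,2}(B⁴)`: `f` is smooth away from the origin, `|f|²` is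
integrable on the unit ball and `‖D²f‖²` is integrable on the punctured unit ball. -/
theorem stmt_1 :
    ContDiffOn ℝ (⊤ : ℕ∞) f (ball (0 : EuclideanSpace ℝ (Fin 4)) 1 \ {0}) ∧
    IntegrableOn (fun x => |f x| ^ 2) (ball (0 : EuclideanSpace ℝ (Fin 4)) 1) volume ∧
    IntegrableOn (fun x => ‖iteratedFDeriv ℝ 2 f x‖ ^ 2)
      (ball (0 : EuclideanSpace ℝ (Fin 4)) 1 \ {0}) volume := by
  refine ⟨fun x hx => (contDiffAt_f hx.2 (mem_ball_zero_iff.1 hx.1)).contDiffWithinAt, ?_, ?_⟩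
  · refine (integrableOn_fun_norm_addHaar volume (f := fun t => |φ t| ^ 2)).2 ?_
    simp only [finrank_euclideanSpace, Fintype.card_fin]
    refine Measure.integrableOn_of_bounded (M := (Real.exp 1 + 1) ^ 2) (by simp)
      ((measurable_id.pow_const 3).smul (measurable_φ.abs.pow_const 2)).aestronglyMeasurable ?_
    filter_upwards [ae_restrict_mem measurableSet_Ioo] with t ht
    have ht0 := ht.1
    have ht1 := ht.2
    rw [smul_eq_mul, sq_abs, Real.norm_of_nonneg (by positivity)]
    have h := φ_le ht0 ht1.le
    have h0 := φ_nonneg ht0.le ht1.le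
    calc t ^ 3 * φ t ^ 2 ≤ t ^ 3 * (Real.exp 1 + t⁻¹) ^ 2 := by gcongr
      _ = t * (Real.exp 1 * t + 1) ^ 2 := by field_simp
      _ ≤ 1 * (Real.exp 1 * 1 + 1) ^ 2 := by gcongr
      _ = _ := by ring
  · have hmeas : Measurable fun x => ‖iteratedFDeriv ℝ 2 f x‖ ^ 2 := by
      simp only [← norm_iteratedFDeriv_fderiv (n := 1), norm_iteratedFDeriv_one]
      exact (measurable_fderiv ℝ _).norm.pow_const 2
    have hint : IntegrableOn (fun x : EuclideanSpace ℝ (Fin 4) =>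
        (3 / (‖x‖ ^ 2 * (Real.exp 1 - Real.log ‖x‖))) ^ 2) (ball 0 1) := by
      refine (integrableOn_fun_norm_addHaar volume
        (f := fun t => (3 / (t ^ 2 * (Real.exp 1 - Real.log t))) ^ 2)).2 ?_
      simp only [finrank_euclideanSpace, Fintype.card_fin]
      refine IntegrableOn.congr_fun
        ((integrableOn_inv_div_sq.mono_set Set.Ioo_subset_Ioc_self).const_mul 9)
        (fun t ht => ?_) measurableSet_Ioo
      have ht0 := ht.1
      have h2 := one_le_exp_one_sub_log ht0.le ht.2.le
      simp only [smul_eq_mul]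
      field_simp
      ring
    refine (hint.mono_set Set.sdiff_subset).mono' hmeas.aestronglyMeasurable ?_
    filter_upwards [ae_restrict_mem (measurableSet_ball.diff (measurableSet_singleton 0))] with x hx
    rw [Real.norm_of_nonneg (by positivity)]
    gcongr
    exact norm_iteratedFDeriv_two_f_le hx.2 (mem_ball_zero_iff.1 hx.1)
end

section
/- The function f is unbounded near the origin and has gradient in L⁴: f(x) → +∞ as x → 0 (i.e., Tendsto f (𝓝[≠] 0) atTop), and ∫_{B⁴} ‖fderiv ℝ f x‖⁴ dx < ∞ (the integral taken over B⁴ \ {0}, a set of full measure). In particular W^{2,2}(B⁴) ∩ W^{1,4}(B⁴) contains unbounded functions. -/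
open MeasureTheory Metric Filter
open scoped Topology

theorem tendsto_exp_one_sub_log_nhdsGT_zero :
    Tendsto (fun t : ℝ => Real.exp 1 - Real.log t) (𝓝[>] 0) atTop := by
  simpa [sub_eq_add_neg] using
    tendsto_atTop_add_const_left _ (Real.exp 1) (tendsto_neg_atBot_atTop.comp
      (Real.tendsto_log_nhdsGT_zero))

theorem tendsto_φ_nhdsGT_zero : Tendsto φ (𝓝[>] 0) atTop :=
  Real.tendsto_log_atTop.comp
    (Real.tendsto_log_atTop.comp tendsto_exp_one_sub_log_nhdsGT_zero)

theorem tendsto_f_nhdsNE_zero :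
    Tendsto f (𝓝[≠] (0 : EuclideanSpace ℝ (Fin 4))) atTop :=
  tendsto_φ_nhdsGT_zero.comp tendsto_norm_nhdsNE_zero

theorem exp_one_le_exp_one_sub_log {t : ℝ} (h0 : 0 ≤ t) (h1 : t ≤ 1) :
    Real.exp 1 ≤ Real.exp 1 - Real.log t := by
  linarith [Real.log_nonpos h0 h1]

theorem hasDerivAt_exp_one_sub_log {t : ℝ} (ht : t ≠ 0) :
    HasDerivAt (fun s => Real.exp 1 - Real.log s) (-t⁻¹) t :=
  (Real.hasDerivAt_log ht).const_sub _

theorem hasDerivAt_φ {t : ℝ} (h0 : 0 < t) (h1 : t ≤ 1) :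
    HasDerivAt φ (-t⁻¹ / (Real.exp 1 - Real.log t) / Real.log (Real.exp 1 - Real.log t)) t := by
  have hL := exp_one_le_exp_one_sub_log h0.le h1
  have hL1 : 1 < Real.exp 1 - Real.log t :=
    (Real.one_lt_exp_iff.2 one_pos).trans_le hL
  exact ((hasDerivAt_exp_one_sub_log h0.ne').log (by linarith)).log (Real.log_pos hL1).ne'

theorem norm_fderiv_f_le {x : EuclideanSpace ℝ (Fin 4)} (h0 : x ≠ 0) (h1 : ‖x‖ ≤ 1) :
    ‖fderiv ℝ f x‖ ≤ (‖x‖ * (Real.exp 1 - Real.log ‖x‖))⁻¹ := by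
  have hx : 0 < ‖x‖ := norm_pos_iff.2 h0
  have hL := exp_one_le_exp_one_sub_log hx.le h1
  have hL0 : 0 < Real.exp 1 - Real.log ‖x‖ := (Real.exp_pos 1).trans_le hL
  have hlog : 1 ≤ Real.log (Real.exp 1 - Real.log ‖x‖) := (Real.le_log_iff_exp_le hL0).2 hL
  have hnorm : HasFDerivAt (fun y : EuclideanSpace ℝ (Fin 4) => ‖y‖) (fderiv ℝ (‖·‖) x) x :=
    ((contDiffAt_norm (n := 1) ℝ h0).differentiableAt one_ne_zero).hasFDerivAt
  have hnorm_le : ‖fderiv ℝ (fun y : EuclideanSpace ℝ (Fin 4) => ‖y‖) x‖ ≤ 1 := by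
    simpa using norm_fderiv_le_of_lipschitz ℝ (x₀ := x)
      (lipschitzWith_one_norm (E := EuclideanSpace ℝ (Fin 4)))
  have hf : fderiv ℝ f x = _ := ((hasDerivAt_φ hx h1).comp_hasFDerivAt x hnorm).fderiv
  rw [hf, norm_smul, norm_div, norm_div, norm_neg, norm_inv, norm_norm,
    Real.norm_of_nonneg hL0.le, Real.norm_of_nonneg (zero_le_one.trans hlog), mul_inv,
    ← div_eq_mul_inv]
  exact (mul_le_of_le_one_right (by positivity) hnorm_le).trans
    (div_le_self (by positivity) hlog)

theorem integrableOn_inv_mul_exp_one_sub_log_pow :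
    IntegrableOn (fun t : ℝ => (t * (Real.exp 1 - Real.log t) ^ 4)⁻¹) (Set.Ioo 0 1) := by
  have hpos {t : ℝ} (h0 : 0 ≤ t) (h1 : t ≤ 1) : 0 < Real.exp 1 - Real.log t :=
    (Real.exp_pos 1).trans_le (exp_one_le_exp_one_sub_log h0 h1)
  let G : ℝ → ℝ := fun t => ((Real.exp 1 - Real.log t) ^ 3)⁻¹ / 3
  have hG {t : ℝ} (h0 : 0 < t) (h1 : t ≤ 1) :
      HasDerivAt G (t * (Real.exp 1 - Real.log t) ^ 4)⁻¹ t := by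
    have hL := (hpos h0.le h1).ne'
    convert! (((hasDerivAt_exp_one_sub_log h0.ne').pow 3).inv (pow_ne_zero 3 hL)).div_const 3
      using 1
    simp only [Pi.pow_apply]
    push_cast
    field_simp
  refine (intervalIntegral.integrableOn_deriv_of_nonneg (g := Function.update G 0 0)
    ?_ (fun t ht => ?_) (fun t ht => ?_)).mono_set Set.Ioo_subset_Ioc_self
  · refine continuousOn_update_iff.2 ⟨fun t ht => ?_, fun _ => ?_⟩
    · exact (hG (ht.1.1.lt_of_ne' ht.2) ht.1.2).continuousAt.continuousWithinAt
    · have hlim : Tendsto G (𝓝[>] 0) (𝓝 0) := by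
        simpa using (((tendsto_pow_atTop three_ne_zero).comp
          tendsto_exp_one_sub_log_nhdsGT_zero).inv_tendsto_atTop).div_const (3 : ℝ)
      exact hlim.mono_left (nhdsWithin_mono _ fun t ht => ht.1.1.lt_of_ne' ht.2)
  · refine (hG ht.1 ht.2.le).congr_of_eventuallyEq ?_
    filter_upwards [isOpen_ne.mem_nhds ht.1.ne'] with s hs
    exact Function.update_of_ne hs _ _
  · have := hpos ht.1.le ht.2.le
    have := ht.1
    positivity

theorem integrableOn_norm_fderiv_f_pow :
    IntegrableOn (fun x => ‖fderiv ℝ f x‖ ^ 4)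
      (ball (0 : EuclideanSpace ℝ (Fin 4)) 1 \ {0}) volume := by
  have hbound : IntegrableOn
      (fun x : EuclideanSpace ℝ (Fin 4) => (‖x‖ * (Real.exp 1 - Real.log ‖x‖))⁻¹ ^ 4)
      (ball 0 1) volume := by
    refine (integrableOn_fun_norm_addHaar volume
      (f := fun t => (t * (Real.exp 1 - Real.log t))⁻¹ ^ 4)).2 ?_
    refine integrableOn_inv_mul_exp_one_sub_log_pow.congr_fun (fun t ht => ?_) measurableSet_Ioo
    have ht0 := ht.1.ne'
    simp only [finrank_euclideanSpace, Fintype.card_fin, smul_eq_mul, inv_pow, mul_pow, mul_inv]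
    field_simp
  refine (hbound.mono_set Set.sdiff_subset).mono'
    ((measurable_fderiv ℝ f).norm.pow_const 4).aestronglyMeasurable ?_
  refine (ae_restrict_iff' (measurableSet_ball.diff (measurableSet_singleton 0))).2
    (ae_of_all _ fun x hx => ?_)
  rw [Real.norm_of_nonneg (by positivity)]
  exact pow_le_pow_left₀ (norm_nonneg _)
    (norm_fderiv_f_le hx.2 (mem_ball_zero_iff.1 hx.1).le) 4

/-- `f` is unbounded near the origin (`f(x) → +∞` as `x → 0`) and its gradient is in
`L⁴` of the punctured unit ball: `W^{2,2} ∩ W^{1,4}` contains unbounded functions. -/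
theorem stmt_2 :
    Tendsto f (𝓝[≠] (0 : EuclideanSpace ℝ (Fin 4))) atTop ∧
    IntegrableOn (fun x => ‖fderiv ℝ f x‖ ^ 4)
      (ball (0 : EuclideanSpace ℝ (Fin 4)) 1 \ {0}) volume :=
  ⟨tendsto_f_nhdsNE_zero, integrableOn_norm_fderiv_f_pow⟩
end

section
/- There exists a constant C > 0 such that for every x with 0 < ‖x‖ < 1, the Hessian of f satisfies the pointwise bound ‖iteratedFDeriv ℝ 2 f x‖ ≤ C / ( ‖x‖² · (e − log ‖x‖) · log(e − log ‖x‖) ). -/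
/-- The function `s ↦ e − (log s) / 2`, so that `innerLog (t ^ 2) = e − log t`. -/
noncomputable def innerLog (s : ℝ) : ℝ := Real.exp 1 - Real.log s / 2

/-- The derivative of `s ↦ log (log (innerLog s))` is `-(2 * profile s)⁻¹`. -/
noncomputable def profile (s : ℝ) : ℝ := s * innerLog s * Real.log (innerLog s)

lemma innerLog_norm_sq (x : EuclideanSpace ℝ (Fin 4)) :
    innerLog (‖x‖ ^ 2) = Real.exp 1 - Real.log ‖x‖ := by
  rw [innerLog, Real.log_pow]
  push_cast
  ring

lemma exp_one_le_innerLog {s : ℝ} (h0 : 0 < s) (h1 : s < 1) : Real.exp 1 ≤ innerLog s := by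
  have := Real.log_nonpos h0.le h1.le
  rw [innerLog]
  linarith

lemma one_le_innerLog {s : ℝ} (h0 : 0 < s) (h1 : s < 1) : 1 ≤ innerLog s :=
  (Real.one_le_exp zero_le_one).trans (exp_one_le_innerLog h0 h1)

lemma one_le_log_innerLog {s : ℝ} (h0 : 0 < s) (h1 : s < 1) : 1 ≤ Real.log (innerLog s) :=
  (Real.le_log_iff_exp_le (zero_lt_one.trans_le (one_le_innerLog h0 h1))).2
    (exp_one_le_innerLog h0 h1)

lemma profile_pos {s : ℝ} (h0 : 0 < s) (h1 : s < 1) : 0 < profile s := by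
  have := one_le_innerLog h0 h1
  have := one_le_log_innerLog h0 h1
  rw [profile]
  positivity

lemma hasDerivAt_innerLog {s : ℝ} (h0 : 0 < s) : HasDerivAt innerLog (-(s⁻¹ / 2)) s :=
  ((Real.hasDerivAt_log h0.ne').div_const 2).const_sub _

lemma hasDerivAt_log_log_innerLog {s : ℝ} (h0 : 0 < s) (h1 : s < 1) :
    HasDerivAt (fun s ↦ Real.log (Real.log (innerLog s))) (-(2 * profile s)⁻¹) s := by
  have hL := zero_lt_one.trans_le (one_le_innerLog h0 h1)
  have hM := zero_lt_one.trans_le (one_le_log_innerLog h0 h1)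
  refine (((hasDerivAt_innerLog h0).log hL.ne').log hM.ne').congr_deriv ?_
  rw [profile]
  field_simp

lemma hasDerivAt_profile {s : ℝ} (h0 : 0 < s) (h1 : s < 1) :
    HasDerivAt profile
      (innerLog s * Real.log (innerLog s) - Real.log (innerLog s) / 2 - 1 / 2) s := by
  have hL := zero_lt_one.trans_le (one_le_innerLog h0 h1)
  have hd := hasDerivAt_innerLog h0
  refine (((hasDerivAt_id s).mul hd).mul (hd.log hL.ne')).congr_deriv ?_
  simp only [id, Pi.mul_apply]
  field_simp
  ring

lemma abs_deriv_profile_mul_le {s : ℝ} (h0 : 0 < s) (h1 : s < 1) :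
    |deriv profile s| * s ≤ profile s := by
  have hL := one_le_innerLog h0 h1
  have hM := one_le_log_innerLog h0 h1
  rw [(hasDerivAt_profile h0 h1).deriv, profile, abs_of_nonneg (by nlinarith)]
  nlinarith

lemma hasFDerivAt_f_s6 {x : EuclideanSpace ℝ (Fin 4)} (h0 : 0 < ‖x‖) (h1 : ‖x‖ < 1) :
    HasFDerivAt f (-(profile (‖x‖ ^ 2))⁻¹ • innerSL ℝ x) x := by
  have hs : ‖x‖ ^ 2 < 1 := pow_lt_one₀ h0.le h1 two_ne_zero
  have hf : f = (fun s ↦ Real.log (Real.log (innerLog s))) ∘ fun y ↦ ‖y‖ ^ 2 := by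
    ext y
    simp only [f, φ, Function.comp_apply, innerLog_norm_sq]
  rw [hf]
  refine ((hasDerivAt_log_log_innerLog (by positivity) hs).comp_hasFDerivAt x
    (hasStrictFDerivAt_norm_sq x).hasFDerivAt).congr_fderiv ?_
  ext y
  simp
  ring

/-- The real inner product as a continuous bilinear map. -/
noncomputable def innerBilin :
    EuclideanSpace ℝ (Fin 4) →L[ℝ] EuclideanSpace ℝ (Fin 4) →L[ℝ] ℝ :=
  innerSL ℝ

lemma norm_innerBilin_le : ‖innerBilin‖ ≤ 1 :=
  norm_innerSL_le ℝ

lemma hasFDerivAt_fderiv_f {x : EuclideanSpace ℝ (Fin 4)} (h0 : 0 < ‖x‖) (h1 : ‖x‖ < 1) :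
    HasFDerivAt (fderiv ℝ f)
      (-(profile (‖x‖ ^ 2))⁻¹ • innerBilin +
        ((deriv profile (‖x‖ ^ 2) / profile (‖x‖ ^ 2) ^ 2) • (2 • innerSL ℝ x)).smulRight
          (innerSL ℝ x)) x := by
  have hx0 : 0 < ‖x‖ ^ 2 := by positivity
  have hs : ‖x‖ ^ 2 < 1 := pow_lt_one₀ h0.le h1 two_ne_zero
  have hloc : fderiv ℝ f =ᶠ[nhds x]
      fun y ↦ -(profile (‖y‖ ^ 2))⁻¹ • innerSL ℝ y := by
    filter_upwards [continuous_norm.continuousAt.eventually_const_lt h0,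
      continuous_norm.continuousAt.eventually_lt_const h1] with y hy0 hy1
    exact (hasFDerivAt_f_s6 hy0 hy1).fderiv
  have hp : HasDerivAt (fun s ↦ -(profile s)⁻¹)
      (deriv profile (‖x‖ ^ 2) / profile (‖x‖ ^ 2) ^ 2) (‖x‖ ^ 2) := by
    refine ((hasDerivAt_profile hx0 hs).differentiableAt.hasDerivAt.inv
      (profile_pos hx0 hs).ne').neg.congr_deriv ?_
    ring
  exact ((hp.comp_hasFDerivAt x (hasStrictFDerivAt_norm_sq x).hasFDerivAt).smul
    innerBilin.hasFDerivAt).congr_of_eventuallyEq hloc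

/-- Pointwise bound for the Hessian of `f` on the punctured unit ball:
`‖D²f(x)‖ ≲ 1/(‖x‖² (e − log ‖x‖) log(e − log ‖x‖))`. -/
theorem stmt_6 :
    ∃ C > 0, ∀ x : EuclideanSpace ℝ (Fin 4), 0 < ‖x‖ → ‖x‖ < 1 →
      ‖iteratedFDeriv ℝ 2 f x‖ ≤
        C / (‖x‖ ^ 2 * (Real.exp 1 - Real.log ‖x‖) * Real.log (Real.exp 1 - Real.log ‖x‖)) := by
  refine ⟨3, by norm_num, fun x h0 h1 ↦ ?_⟩
  have hx0 : 0 < ‖x‖ ^ 2 := by positivity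
  have hs : ‖x‖ ^ 2 < 1 := pow_lt_one₀ h0.le h1 two_ne_zero
  have hP := profile_pos hx0 hs
  have hD := abs_deriv_profile_mul_le hx0 hs
  have hden : ‖x‖ ^ 2 * (Real.exp 1 - Real.log ‖x‖) * Real.log (Real.exp 1 - Real.log ‖x‖) =
      profile (‖x‖ ^ 2) := by
    rw [profile, innerLog_norm_sq]
  rw [hden, ← norm_iteratedFDeriv_fderiv, norm_iteratedFDeriv_one,
    (hasFDerivAt_fderiv_f h0 h1).fderiv]
  set s := ‖x‖ ^ 2 with hsdef
  have hI : ‖-(profile s)⁻¹ • innerBilin‖ ≤ 1 / profile s := by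
    refine (ContinuousLinearMap.opNorm_smul_le _ _).trans ?_
    rw [norm_neg, norm_inv, Real.norm_of_nonneg hP.le, one_div]
    exact mul_le_of_le_one_right (by positivity) norm_innerBilin_le
  have hR : ‖((deriv profile s / profile s ^ 2) • (2 • innerSL ℝ x)).smulRight
      (innerSL ℝ x)‖ ≤ 2 / profile s := by
    have h2 : ‖2 • innerSL ℝ x‖ = 2 * ‖x‖ := by
      rw [← Nat.cast_smul_eq_nsmul ℝ, norm_smul, innerSL_apply_norm]
      norm_num
    rw [ContinuousLinearMap.norm_smulRight_apply, norm_smul, h2, innerSL_apply_norm, norm_div,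
      norm_pow, Real.norm_of_nonneg hP.le, Real.norm_eq_abs]
    calc |deriv profile s| / profile s ^ 2 * (2 * ‖x‖) * ‖x‖
        = 2 * (|deriv profile s| * s) / profile s ^ 2 := by rw [hsdef]; ring
      _ ≤ 2 * profile s / profile s ^ 2 := by gcongr
      _ = 2 / profile s := by field_simp
  calc _ ≤ 1 / profile s + 2 / profile s := (norm_add_le _ _).trans (add_le_add hI hR)
    _ = 3 / profile s := by ring
end

section
/- The square of the Hessian majorant of f is integrable over the unit ball: ∫_{B⁴} ( 1 / ( ‖x‖² · (e − log ‖x‖) · log(e − log ‖x‖) ) )² dx < ∞, where the integral is over the punctured open unit ball {x : 0 < ‖x‖ < 1} in EuclideanSpace ℝ (Fin 4). -/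
open MeasureTheory

open Set Filter Topology

/-- `1 / (r (c - log r)²)` is the derivative of `1 / (c - log r)`, hence integrable near `0`. -/
lemma integrableOn_inv_mul_sub_log_sq {c : ℝ} (hc : 0 < c) :
    IntegrableOn (fun r : ℝ => 1 / (r * (c - Real.log r) ^ 2)) (Ioc 0 1) := by
  have hpos : ∀ r ∈ Ioc (0 : ℝ) 1, 0 < c - Real.log r := fun r hr => by
    linarith [Real.log_nonpos hr.1.le hr.2]
  have hlim : Tendsto (fun r : ℝ => (c - Real.log r)⁻¹) (𝓝[>] 0) (𝓝 0) := by
    refine tendsto_inv_atTop_zero.comp ?_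
    simpa only [sub_eq_add_neg, Function.comp_apply] using
      tendsto_atTop_add_const_left _ c (tendsto_neg_atBot_atTop.comp Real.tendsto_log_nhdsGT_zero)
  refine intervalIntegral.integrableOn_deriv_of_nonneg
    (g := Function.update (fun r : ℝ => (c - Real.log r)⁻¹) 0 0) ?_ ?_ ?_
  · rw [continuousOn_update_iff, Icc_sdiff_left]
    refine ⟨fun r hr => ?_, fun _ => hlim.mono_left (nhdsWithin_mono _ Ioc_subset_Ioi_self)⟩
    exact ((continuousAt_const.sub (Real.continuousAt_log hr.1.ne')).inv₀
      (hpos r hr).ne').continuousWithinAt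
  · intro r hr
    have hL := (hpos r (Ioo_subset_Ioc_self hr)).ne'
    have hr0 := hr.1.ne'
    have h := ((Real.hasDerivAt_log hr0).const_sub c).inv hL
    refine (h.congr_of_eventuallyEq ?_).congr_deriv ?_
    · filter_upwards [isOpen_ne.mem_nhds hr0] with y hy
      exact Function.update_of_ne hy _ _
    · field_simp
  · intro r hr
    have := hr.1
    positivity

/-- The square of the Hessian majorant of `f` is integrable over the punctured unit ball
in `ℝ⁴`. -/
theorem stmt_7 :
    IntegrableOn
      (fun x : EuclideanSpace ℝ (Fin 4) =>
        (1 / (‖x‖ ^ 2 * (Real.exp 1 - Real.log ‖x‖) *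
          Real.log (Real.exp 1 - Real.log ‖x‖))) ^ 2)
      {x : EuclideanSpace ℝ (Fin 4) | 0 < ‖x‖ ∧ ‖x‖ < 1} volume := by
  have hsub : {x : EuclideanSpace ℝ (Fin 4) | 0 < ‖x‖ ∧ ‖x‖ < 1} ⊆ Metric.ball 0 1 :=
    fun x hx => by simpa using hx.2
  refine IntegrableOn.mono_set ?_ hsub
  refine (integrableOn_fun_norm_addHaar (volume : Measure (EuclideanSpace ℝ (Fin 4)))
    (f := fun r : ℝ => (1 / (r ^ 2 * (Real.exp 1 - Real.log r) *
      Real.log (Real.exp 1 - Real.log r))) ^ 2)).2 ?_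
  refine Integrable.mono' ((integrableOn_inv_mul_sub_log_sq (Real.exp_pos 1)).mono_set
    Ioo_subset_Ioc_self) (Measurable.aestronglyMeasurable (by fun_prop)) ?_
  filter_upwards [ae_restrict_mem measurableSet_Ioo] with r hr
  have hr0 : 0 < r := hr.1
  have hL : Real.exp 1 ≤ Real.exp 1 - Real.log r := by
    linarith [Real.log_nonpos hr.1.le hr.2.le]
  have hL0 := (Real.exp_pos 1).trans_le hL
  have hlog : 1 ≤ Real.log (Real.exp 1 - Real.log r) := (Real.le_log_iff_exp_le hL0).2 hL
  rw [Real.norm_of_nonneg (by positivity), finrank_euclideanSpace_fin, smul_eq_mul]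
  generalize Real.exp 1 - Real.log r = L at *
  generalize Real.log L = M at *
  have hM0 : 0 < M := one_pos.trans_le hlog
  calc r ^ (4 - 1) * (1 / (r ^ 2 * L * M)) ^ 2 = 1 / (r * L ^ 2 * M ^ 2) := by
        field_simp
    _ ≤ 1 / (r * L ^ 2) :=
        one_div_le_one_div_of_le (by positivity)
          (le_mul_of_one_le_right (by positivity) (one_le_pow₀ hlog))
end

section
/- The function w is not twice continuously differentiable at the origin: ¬ ContDiffAt ℝ 2 w 0. (Equivalently, the second partial derivative ∂²w/∂x₁², which is defined on B⁴ \ {0}, has no limit as x → 0, so w ∈ C¹ \ C².) -/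
/-- `w(x) = ‖x‖² sin(φ(‖x‖))`; since `φ 0 = 0` this gives `w 0 = 0` as well. -/
noncomputable def w (x : EuclideanSpace ℝ (Fin 4)) : ℝ := ‖x‖ ^ 2 * Real.sin (φ ‖x‖)

open Filter Topology Asymptotics

/-- The parametrization `s ↦ exp (e - exp (exp s))` is a right inverse of `φ`. -/
theorem φ_exp_sub_exp_exp (s : ℝ) : φ (Real.exp (Real.exp 1 - Real.exp (Real.exp s))) = s := by
  simp [φ]

theorem tendsto_exp_sub_exp_exp (a : ℝ) :
    Tendsto (fun s : ℝ => Real.exp (a - Real.exp (Real.exp s))) atTop (𝓝 0) := by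
  refine Real.tendsto_exp_atBot.comp (tendsto_atBot_add_const_left _ a ?_)
  exact tendsto_neg_atTop_atBot.comp (Real.tendsto_exp_atTop.comp Real.tendsto_exp_atTop)

theorem not_tendsto_sin_atTop (c : ℝ) : ¬ Tendsto Real.sin atTop (𝓝 c) := by
  intro h
  have hu : Tendsto (fun n : ℕ => (n : ℝ) * (2 * Real.pi)) atTop atTop :=
    tendsto_natCast_atTop_atTop.atTop_mul_const Real.two_pi_pos
  have h0 := h.comp hu
  have h1 := h.comp (tendsto_atTop_add_const_left _ (Real.pi / 2) hu)
  have e0 : Real.sin ∘ (fun n : ℕ => (n : ℝ) * (2 * Real.pi)) = fun _ => 0 := by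
    ext n
    simpa using Real.sin_add_nat_mul_two_pi 0 n
  have e1 : Real.sin ∘ (fun n : ℕ => Real.pi / 2 + (n : ℝ) * (2 * Real.pi)) = fun _ => 1 := by
    ext n
    simp [Real.sin_add_nat_mul_two_pi]
  rw [e0] at h0
  rw [e1] at h1
  exact zero_ne_one
    ((tendsto_nhds_unique tendsto_const_nhds h0).trans
      (tendsto_nhds_unique tendsto_const_nhds h1).symm)

/-- An even function that is `C²` at the origin has an expansion
`f x = f 0 + c * x ^ 2 + o(x ^ 2)`. -/
theorem ContDiffAt.exists_isLittleO_of_even {f : ℝ → ℝ} (hf : ContDiffAt ℝ 2 f 0)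
    (heven : ∀ x, f (-x) = f x) :
    ∃ c : ℝ, (fun x => f x - f 0 - c * x ^ 2) =o[𝓝 0] fun x => x ^ 2 := by
  obtain ⟨u, hu, hfu⟩ := hf.contDiffOn (m := 2) le_rfl (by simp)
  obtain ⟨ε, hε, hball⟩ := Metric.mem_nhds_iff.1 hu
  have hT := taylor_isLittleO (n := 2) (convex_ball (0 : ℝ) ε) (Metric.mem_ball_self hε)
    (hfu.mono hball)
  rw [nhdsWithin_eq_nhds.2 (Metric.ball_mem_nhds _ hε)] at hT
  have hneg : Tendsto (fun x : ℝ => -x) (𝓝 0) (𝓝 0) := by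
    simpa using (continuous_neg (G := ℝ)).tendsto 0
  have hT' := hT.comp_tendsto hneg
  simp only [taylorWithinEval_succ, taylor_within_zero_eval, Function.comp_def, sub_zero,
    heven, neg_sq] at hT hT'
  refine ⟨iteratedDerivWithin 2 f (Metric.ball 0 ε) 0 / 2, ?_⟩
  refine ((hT.add hT').const_mul_left (1 / 2)).congr_left fun x => ?_
  simp [smul_eq_mul]
  ring

/-- `w` is not twice continuously differentiable at the origin: `w ∈ C¹ \ C²`. -/
theorem stmt_11 : ¬ ContDiffAt ℝ 2 w 0 := by
  intro h
  set e : EuclideanSpace ℝ (Fin 4) := EuclideanSpace.single 0 1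
  have hline (t : ℝ) : w (t • e) = t ^ 2 * Real.sin (φ |t|) := by
    simp [w, e, norm_smul]
  have hg : ContDiffAt ℝ 2 (fun t : ℝ => w (t • e)) 0 := by
    refine ContDiffAt.comp (0 : ℝ) (g := w) (by simpa using h) ?_
    fun_prop
  obtain ⟨c, hc⟩ := hg.exists_isLittleO_of_even fun t => by simp only [hline, neg_sq, abs_neg]
  have hs := (hc.comp_tendsto (tendsto_exp_sub_exp_exp (Real.exp 1))).tendsto_div_nhds_zero
  refine not_tendsto_sin_atTop c (tendsto_sub_nhds_zero_iff.1 (hs.congr fun s => ?_))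
  simp only [Function.comp_apply, hline, Real.abs_exp, φ_exp_sub_exp_exp]
  have := (Real.exp_pos (Real.exp 1 - Real.exp (Real.exp s))).ne'
  field_simp
  simp
  ring
end

section
/- There exists a constant C > 0 such that for every x with 0 < ‖x‖ < 1, the third derivative of w satisfies the pointwise bound ‖iteratedFDeriv ℝ 3 w x‖ ≤ C / ( ‖x‖ · (e − log ‖x‖) · log(e − log ‖x‖) ). -/
open scoped Topology

section
variable {E : Type*} [NormedAddCommGroup E] [InnerProductSpace ℝ E]

theorem fderiv_const_mul_norm_sq (c : ℝ) :
    fderiv ℝ (fun y : E => c * ‖y‖ ^ 2) = ⇑((2 * c) • innerSL ℝ (E := E)) := by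
  ext1 x
  rw [((hasStrictFDerivAt_norm_sq x).hasFDerivAt.const_mul c).fderiv]
  ext y
  simp
  ring

theorem norm_iteratedFDeriv_one_const_mul_norm_sq (c : ℝ) (x : E) :
    ‖iteratedFDeriv ℝ 1 (fun y : E => c * ‖y‖ ^ 2) x‖ = 2 * |c| * ‖x‖ := by
  rw [← norm_iteratedFDeriv_fderiv, fderiv_const_mul_norm_sq, norm_iteratedFDeriv_zero,
    smul_apply, norm_smul, innerSL_apply_norm]
  simp

theorem norm_iteratedFDeriv_two_const_mul_norm_sq_le (c : ℝ) (x : E) :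
    ‖iteratedFDeriv ℝ 2 (fun y : E => c * ‖y‖ ^ 2) x‖ ≤ 2 * |c| := by
  rw [← norm_iteratedFDeriv_fderiv, fderiv_const_mul_norm_sq, ← norm_iteratedFDeriv_fderiv,
    norm_iteratedFDeriv_zero, ContinuousLinearMap.fderiv, norm_smul]
  have := norm_innerSL_le ℝ (E := E)
  simpa using mul_le_of_le_one_right (by positivity : 0 ≤ 2 * |c|) this

theorem iteratedFDeriv_three_const_mul_norm_sq (c : ℝ) (x : E) :
    iteratedFDeriv ℝ 3 (fun y : E => c * ‖y‖ ^ 2) x = 0 := by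
  rw [← norm_eq_zero, ← norm_iteratedFDeriv_fderiv, fderiv_const_mul_norm_sq,
    ← norm_iteratedFDeriv_fderiv]
  have : fderiv ℝ ⇑((2 * c) • innerSL ℝ (E := E)) = fun _ => (2 * c) • innerSL ℝ (E := E) := by
    ext1 y
    exact ContinuousLinearMap.fderiv _
  rw [this, iteratedFDeriv_succ_const]
  simp

/-- Third derivative bound for `G(‖y‖² / ‖x‖²)` at `y = x`, in terms of all derivatives of `G` of
order at most three at `1`. -/
theorem norm_iteratedFDeriv_three_comp_norm_sq_le_of_forall_le {G : ℝ → ℝ} {B : ℝ} {x : E}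
    (hx : x ≠ 0) (hG : ContDiffAt ℝ 3 G 1) (hB : ∀ i ≤ 3, |iteratedDeriv i G 1| ≤ B) :
    ‖iteratedFDeriv ℝ 3 (fun y => G ((‖x‖ ^ 2)⁻¹ * ‖y‖ ^ 2)) x‖ ≤ 48 * B / ‖x‖ ^ 3 := by
  have hx' : 0 < ‖x‖ := norm_pos_iff.2 hx
  set f : E → ℝ := fun y => (‖x‖ ^ 2)⁻¹ * ‖y‖ ^ 2 with hf
  have hfx : f x = 1 := by simp only [hf]; field_simp
  have hfs : ContDiff ℝ 3 f := contDiff_const.mul (contDiff_norm_sq ℝ)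
  obtain ⟨t, ht, hto, h1t⟩ := eventually_nhds_iff.1 (hG.eventually (by simp))
  have hso : IsOpen (f ⁻¹' t) := hto.preimage hfs.continuous
  have hxs : x ∈ f ⁻¹' t := by simpa [hfx] using h1t
  have key := norm_iteratedFDerivWithin_comp_le (n := 3) (x := x) (C := B) (D := 2 / ‖x‖)
    (fun y hy => (ht y hy).contDiffWithinAt) (hfs.contDiffOn (s := f ⁻¹' t)) le_rfl
    hto.uniqueDiffOn hso.uniqueDiffOn (Set.mapsTo_preimage f t) hxs ?_ ?_
  · rw [iteratedFDerivWithin_of_isOpen 3 hso hxs] at key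
    refine key.trans_eq ?_
    simp [Nat.factorial]
    ring
  · intro i hi
    rw [hfx, iteratedFDerivWithin_of_isOpen i hto h1t, norm_iteratedFDeriv_eq_norm_iteratedDeriv]
    exact hB i hi
  · intro i hi1 hi3
    rw [iteratedFDerivWithin_of_isOpen i hso hxs]
    interval_cases i
    · rw [norm_iteratedFDeriv_one_const_mul_norm_sq, abs_of_pos (by positivity)]
      apply le_of_eq
      field_simp
    · refine (norm_iteratedFDeriv_two_const_mul_norm_sq_le _ _).trans ?_
      rw [abs_of_pos (by positivity), div_pow, div_eq_mul_inv]
      gcongr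
      norm_num
    · rw [iteratedFDeriv_three_const_mul_norm_sq]
      simp only [norm_zero]
      positivity

/-- Third derivative bound for `G(‖y‖² / ‖x‖²)` at `y = x`. Only the second and third derivatives of
`G` at `1` matter, since affine functions of `‖y‖²` have zero third derivative. -/
theorem norm_iteratedFDeriv_three_comp_norm_sq_le {G : ℝ → ℝ} {B : ℝ} {x : E}
    (hx : x ≠ 0) (hG : ContDiffAt ℝ 3 G 1) (h2 : |iteratedDeriv 2 G 1| ≤ B)
    (h3 : |iteratedDeriv 3 G 1| ≤ B) :
    ‖iteratedFDeriv ℝ 3 (fun y => G ((‖x‖ ^ 2)⁻¹ * ‖y‖ ^ 2)) x‖ ≤ 48 * B / ‖x‖ ^ 3 := by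
  have hB : 0 ≤ B := (abs_nonneg _).trans h2
  set P : ℝ → ℝ := fun σ => G 1 + deriv G 1 * (σ - 1) with hP
  have hPs : ContDiff ℝ 3 P := by fun_prop
  have hPd : deriv P = fun _ => deriv G 1 := by
    ext σ
    simp [hP]
  have hfs : ContDiff ℝ 3 (fun y : E => (‖x‖ ^ 2)⁻¹ * ‖y‖ ^ 2) :=
    contDiff_const.mul (contDiff_norm_sq ℝ)
  have hflat := norm_iteratedFDeriv_three_comp_norm_sq_le_of_forall_le (G := G - P) (B := B) hx
    (hG.sub hPs.contDiffAt) fun i hi => by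
      rw [iteratedDeriv_sub (hG.of_le (by exact_mod_cast hi))
        (hPs.contDiffAt.of_le (by exact_mod_cast hi))]
      interval_cases i
      · simpa [hP] using hB
      · simpa [iteratedDeriv_one, hPd] using hB
      · simpa [iteratedDeriv_succ' (f := P), hPd] using h2
      · simpa [iteratedDeriv_succ' (f := P), hPd, iteratedDeriv_const] using h3
  have hPf : iteratedFDeriv ℝ 3 (fun y : E => P ((‖x‖ ^ 2)⁻¹ * ‖y‖ ^ 2)) x = 0 := by
    have : (fun y : E => P ((‖x‖ ^ 2)⁻¹ * ‖y‖ ^ 2)) =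
        (fun y => deriv G 1 * (‖x‖ ^ 2)⁻¹ * ‖y‖ ^ 2) + fun _ => G 1 - deriv G 1 := by
      ext y
      simp [hP]
      ring
    rw [this, iteratedFDeriv_add_apply (contDiff_const.mul (contDiff_norm_sq ℝ)).contDiffAt
      contDiffAt_const, iteratedFDeriv_three_const_mul_norm_sq, iteratedFDeriv_succ_const]
    simp
  have hx1 : (‖x‖ ^ 2)⁻¹ * ‖x‖ ^ 2 = 1 := inv_mul_cancel₀ (by positivity)
  have hGc : ContDiffAt ℝ 3 (fun y : E => G ((‖x‖ ^ 2)⁻¹ * ‖y‖ ^ 2)) x :=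
    ContDiffAt.comp x (by rwa [hx1]) hfs.contDiffAt
  have hsub : (fun y : E => (G - P) ((‖x‖ ^ 2)⁻¹ * ‖y‖ ^ 2)) =
      (fun y => G ((‖x‖ ^ 2)⁻¹ * ‖y‖ ^ 2)) - fun y => P ((‖x‖ ^ 2)⁻¹ * ‖y‖ ^ 2) := rfl
  have hPc : ContDiffAt ℝ 3 (fun y : E => P ((‖x‖ ^ 2)⁻¹ * ‖y‖ ^ 2)) x :=
    (hPs.comp hfs).contDiffAt
  rwa [hsub, iteratedFDeriv_sub_apply hGc hPc, hPf, sub_zero] at hflat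
end

section
open Real

theorem hasDerivAt_log_log {M : ℝ} (hM : 1 < M) :
    HasDerivAt (fun M => log (log M)) (1 / (M * log M)) M := by
  have hl := log_pos hM
  convert! (hasDerivAt_log (by positivity : M ≠ 0)).log hl.ne' using 1
  field_simp

theorem hasDerivAt_sin_log_log {M : ℝ} (hM : 1 < M) :
    HasDerivAt (fun M => sin (log (log M))) (cos (log (log M)) / (M * log M)) M := by
  convert! (hasDerivAt_log_log hM).sin using 1
  ring

theorem hasDerivAt_cos_log_log_div {M : ℝ} (hM : 1 < M) :
    HasDerivAt (fun M => cos (log (log M)) / (M * log M))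
      (-(sin (log (log M)) + cos (log (log M)) * (log M + 1)) / (M * log M) ^ 2) M := by
  have hl := log_pos hM
  have hM0 : 0 < M := by positivity
  convert! (hasDerivAt_log_log hM).cos.div
    ((hasDerivAt_id M).mul (hasDerivAt_log hM0.ne')) (by simp; grind) using 1
  simp
  field_simp
  ring

theorem hasDerivAt_sin_add_cos_log_log_div {M : ℝ} (hM : 1 < M) :
    HasDerivAt
      (fun M => -(sin (log (log M)) + cos (log (log M)) * (log M + 1)) / (M * log M) ^ 2)
      ((2 * (sin (log (log M)) + cos (log (log M)) * (log M + 1)) * (log M + 1) -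
        (cos (log (log M)) - sin (log (log M))) * (log M + 1)) / (M * log M) ^ 3) M := by
  have hl := log_pos hM
  have hM0 : 0 < M := by positivity
  convert! (((hasDerivAt_log_log hM).sin.add ((hasDerivAt_log_log hM).cos.mul
    ((hasDerivAt_log hM0.ne').add_const 1))).neg).div
    (((hasDerivAt_id M).mul (hasDerivAt_log hM0.ne')).pow 2) (by simp; grind) using 1
  simp
  field_simp
  ring

theorem iteratedDeriv_mul_comp_sub_log {L : ℝ} (hL : 1 < L) {p p₁ p₂ p₃ : ℝ → ℝ}
    (h₁ : ∀ M, 1 < M → HasDerivAt p (p₁ M) M) (h₂ : ∀ M, 1 < M → HasDerivAt p₁ (p₂ M) M)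
    (h₃ : ∀ M, 1 < M → HasDerivAt p₂ (p₃ M) M) :
    iteratedDeriv 2 (fun σ => σ * p (L - log σ / 2)) 1 = -p₁ L / 2 + p₂ L / 4 ∧
    iteratedDeriv 3 (fun σ => σ * p (L - log σ / 2)) 1 = p₁ L / 2 - p₃ L / 8 := by
  have hM : ∀ {σ : ℝ}, 0 < σ →
      HasDerivAt (fun σ => L - log σ / 2) (-(1 / (2 * σ))) σ := fun {σ} hσ => by
    convert! ((hasDerivAt_log hσ.ne').div_const 2).const_sub L using 1
    field_simp
  have hev : ∀ᶠ σ : ℝ in 𝓝 1, 0 < σ ∧ 1 < L - log σ / 2 := by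
    refine (lt_mem_nhds one_pos).and ?_
    exact (hM one_pos).continuousAt.eventually (lt_mem_nhds (by simpa using hL))
  have hK₁ : deriv (fun σ => σ * p (L - log σ / 2)) =ᶠ[𝓝 1]
      fun σ => p (L - log σ / 2) - p₁ (L - log σ / 2) / 2 := by
    filter_upwards [hev] with σ ⟨hσ, hl⟩
    have := (hasDerivAt_id σ).mul ((h₁ _ hl).comp σ (hM hσ))
    refine HasDerivAt.deriv ?_
    convert! this using 1
    simp
    field_simp
    ring
  have hK₂ : deriv (deriv fun σ => σ * p (L - log σ / 2)) =ᶠ[𝓝 1]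
      fun σ => (-p₁ (L - log σ / 2) / 2 + p₂ (L - log σ / 2) / 4) / σ := by
    refine hK₁.deriv.trans ?_
    filter_upwards [hev] with σ ⟨hσ, hl⟩
    have := ((h₁ _ hl).comp σ (hM hσ)).sub (((h₂ _ hl).comp σ (hM hσ)).div_const 2)
    refine HasDerivAt.deriv ?_
    convert! this using 1
    field_simp
    ring
  have hK₃ : deriv (deriv (deriv fun σ => σ * p (L - log σ / 2))) 1 = p₁ L / 2 - p₃ L / 8 := by
    rw [hK₂.deriv_eq]
    have hl : 1 < L - log 1 / 2 := by simpa using hL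
    have := (((h₂ _ hl).comp 1 (hM one_pos)).neg.div_const 2).add
      (((h₃ _ hl).comp 1 (hM one_pos)).div_const 4) |>.div (hasDerivAt_id (1 : ℝ)) one_ne_zero
    refine HasDerivAt.deriv ?_
    convert! this using 1
    simp
    ring
  constructor
  · simpa [iteratedDeriv_succ] using hK₂.self_of_nhds
  · simpa [iteratedDeriv_succ] using hK₃

theorem abs_derivs_sin_log_log_le {M : ℝ} (hM : exp 1 ≤ M) :
    |cos (log (log M)) / (M * log M)| ≤ 1 / (M * log M) ∧
    |-(sin (log (log M)) + cos (log (log M)) * (log M + 1)) / (M * log M) ^ 2| ≤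
      3 / (M * log M) ∧
    |(2 * (sin (log (log M)) + cos (log (log M)) * (log M + 1)) * (log M + 1) -
        (cos (log (log M)) - sin (log (log M))) * (log M + 1)) / (M * log M) ^ 3| ≤
      16 / (M * log M) := by
  have hM0 : 0 < M := (exp_pos 1).trans_le hM
  have hM1 : 1 ≤ M := (one_le_exp zero_le_one).trans hM
  have hl : 1 ≤ log M := (le_log_iff_exp_le hM0).2 hM
  set l := log M
  have hD : l ≤ M * l := le_mul_of_one_le_left (by positivity) hM1
  have hD0 : 0 < M * l := by positivity
  set D := M * l
  have hs := abs_sin_le_one (log l)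
  have hc := abs_cos_le_one (log l)
  set s := sin (log l)
  set c := cos (log l)
  have hcl : |c * (l + 1)| ≤ 1 * (l + 1) := by
    rw [abs_mul, abs_of_pos (by positivity : 0 < l + 1)]
    gcongr
  have hN : |s + c * (l + 1)| ≤ l + 2 := by
    linarith [abs_add_le s (c * (l + 1))]
  have hcs : |c - s| ≤ 2 := by
    linarith [abs_sub c s]
  refine ⟨?_, ?_, ?_⟩
  · rw [abs_div, abs_of_pos hD0]
    gcongr
  · rw [abs_div, abs_neg, abs_of_pos (by positivity : 0 < D ^ 2),
      div_le_div_iff₀ (by positivity) hD0]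
    calc |s + c * (l + 1)| * D ≤ (3 * D) * D := by gcongr; linarith
      _ = 3 * D ^ 2 := by ring
  · rw [abs_div, abs_of_pos (by positivity : 0 < D ^ 3),
      div_le_div_iff₀ (by positivity) hD0]
    have : |2 * (s + c * (l + 1)) * (l + 1) - (c - s) * (l + 1)| ≤ 16 * D ^ 2 := by
      calc _ ≤ |2 * (s + c * (l + 1)) * (l + 1)| + |(c - s) * (l + 1)| := abs_sub _ _
        _ = 2 * |s + c * (l + 1)| * (l + 1) + |c - s| * (l + 1) := by
          rw [abs_mul, abs_mul, abs_mul, abs_of_pos (by positivity : 0 < l + 1), abs_two]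
        _ ≤ 2 * (l + 2) * (l + 1) + 2 * (l + 1) := by gcongr
        _ ≤ 16 * l ^ 2 := by nlinarith
        _ ≤ 16 * D ^ 2 := by gcongr
    calc _ ≤ (16 * D ^ 2) * D := by gcongr
      _ = 16 * D ^ 3 := by ring

end

theorem w_eq_mul_comp_norm_sq {x y : EuclideanSpace ℝ (Fin 4)} (hx : x ≠ 0) (hy : y ≠ 0) :
    w y = ‖x‖ ^ 2 * ((‖x‖ ^ 2)⁻¹ * ‖y‖ ^ 2 * Real.sin (Real.log (Real.log
      (Real.exp 1 - Real.log ‖x‖ - Real.log ((‖x‖ ^ 2)⁻¹ * ‖y‖ ^ 2) / 2)))) := by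
  have hx' : 0 < ‖x‖ := norm_pos_iff.2 hx
  have hy' : 0 < ‖y‖ := norm_pos_iff.2 hy
  have : Real.exp 1 - Real.log ‖x‖ - Real.log ((‖x‖ ^ 2)⁻¹ * ‖y‖ ^ 2) / 2 =
      Real.exp 1 - Real.log ‖y‖ := by
    rw [Real.log_mul (by positivity) (by positivity), Real.log_inv, Real.log_pow, Real.log_pow]
    push_cast
    ring
  rw [this, w, φ]
  field_simp

/-- Pointwise bound for the third derivative of `w` on the punctured unit ball:
`‖D³w(x)‖ ≲ 1/(‖x‖ (e − log ‖x‖) log(e − log ‖x‖))`. -/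
theorem stmt_13 :
    ∃ C > 0, ∀ x : EuclideanSpace ℝ (Fin 4), 0 < ‖x‖ → ‖x‖ < 1 →
      ‖iteratedFDeriv ℝ 3 w x‖ ≤
        C / (‖x‖ * (Real.exp 1 - Real.log ‖x‖) * Real.log (Real.exp 1 - Real.log ‖x‖)) := by
  refine ⟨144, by norm_num, fun x hx hx1 => ?_⟩
  have hx0 : x ≠ 0 := norm_pos_iff.1 hx
  set L := Real.exp 1 - Real.log ‖x‖ with hLdef
  have hL : Real.exp 1 ≤ L := by linarith [Real.log_neg hx hx1]
  have hL1 : 1 < L := (Real.one_lt_exp_iff.2 one_pos).trans_le hL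
  have hlog : 0 < Real.log L := Real.log_pos hL1
  set K : ℝ → ℝ := fun σ => σ * Real.sin (Real.log (Real.log (L - Real.log σ / 2))) with hK
  have hKs : ContDiffAt ℝ 3 K 1 := by
    refine contDiffAt_id.mul (ContDiffAt.sin (ContDiffAt.log (ContDiffAt.log (contDiffAt_const.sub
      ((contDiffAt_id.log one_ne_zero).div_const 2)) ?_) ?_))
    · simpa using (one_pos.trans hL1).ne'
    · simpa using hlog.ne'
  obtain ⟨h2, h3⟩ := iteratedDeriv_mul_comp_sub_log hL1 (fun _ => hasDerivAt_sin_log_log)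
    (fun _ => hasDerivAt_cos_log_log_div) (fun _ => hasDerivAt_sin_add_cos_log_log_div)
  obtain ⟨b1, b2, b3⟩ := abs_derivs_sin_log_log_le hL
  have hD : 0 < 1 / (L * Real.log L) := by positivity
  rw [div_eq_mul_one_div (3 : ℝ)] at b2
  rw [div_eq_mul_one_div (16 : ℝ)] at b3
  rw [abs_le] at b1 b2 b3
  have hbound := norm_iteratedFDeriv_three_comp_norm_sq_le (G := K)
    (B := 3 * (1 / (L * Real.log L))) hx0 hKs
    (by rw [h2, abs_le]; constructor <;> linarith) (by rw [h3, abs_le]; constructor <;> linarith)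
  have hKc : ContDiffAt ℝ 3
      (fun y : EuclideanSpace ℝ (Fin 4) => K ((‖x‖ ^ 2)⁻¹ * ‖y‖ ^ 2)) x := by
    have hx1 : (‖x‖ ^ 2)⁻¹ * ‖x‖ ^ 2 = 1 := inv_mul_cancel₀ (by positivity)
    exact ContDiffAt.comp x (by rwa [hx1]) (contDiff_const.mul (contDiff_norm_sq ℝ)).contDiffAt
  have hw : w =ᶠ[𝓝 x] ‖x‖ ^ 2 • fun y => K ((‖x‖ ^ 2)⁻¹ * ‖y‖ ^ 2) := by
    filter_upwards [isOpen_ne.mem_nhds hx0] with y hy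
    exact w_eq_mul_comp_norm_sq hx0 hy
  rw [(hw.iteratedFDeriv ℝ 3).self_of_nhds, iteratedFDeriv_const_smul_apply hKc, norm_smul,
    Real.norm_of_nonneg (by positivity)]
  calc _ ≤ ‖x‖ ^ 2 * (48 * (3 * (1 / (L * Real.log L))) / ‖x‖ ^ 3) := by gcongr
    _ = 144 / (‖x‖ * L * Real.log L) := by field_simp; norm_num
end

section
/- The third derivatives of w are in L⁴ of the unit ball: ∫_{B⁴} ‖iteratedFDeriv ℝ 3 w x‖⁴ dx < ∞, the integral taken over the punctured ball B⁴ \ {0}, a set of full measure. -/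
open MeasureTheory Metric

set_option maxSynthPendingDepth 3 in
lemma norm_iteratedFDeriv_three {𝕜 E F : Type*} [NontriviallyNormedField 𝕜]
    [NormedAddCommGroup E] [NormedSpace 𝕜 E] [NormedAddCommGroup F] [NormedSpace 𝕜 F]
    (f : E → F) (x : E) :
    ‖iteratedFDeriv 𝕜 3 f x‖ = ‖fderiv 𝕜 (fderiv 𝕜 (fderiv 𝕜 f)) x‖ := by
  rw [← norm_iteratedFDeriv_fderiv, ← norm_iteratedFDeriv_fderiv, norm_iteratedFDeriv_one]

set_option maxSynthPendingDepth 3 in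
lemma measurable_norm_iteratedFDeriv_three {𝕜 E F : Type*} [NontriviallyNormedField 𝕜]
    [NormedAddCommGroup E] [NormedSpace 𝕜 E] [MeasurableSpace E] [OpensMeasurableSpace E]
    [NormedAddCommGroup F] [NormedSpace 𝕜 F] [CompleteSpace F] (f : E → F) :
    Measurable fun x => ‖iteratedFDeriv 𝕜 3 f x‖ := by
  simp only [norm_iteratedFDeriv_three]
  borelize (E →L[𝕜] E →L[𝕜] E →L[𝕜] F)
  exact (measurable_fderiv 𝕜 (fderiv 𝕜 (fderiv 𝕜 f))).norm

set_option maxSynthPendingDepth 3 in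
/-- The third derivative of `x ↦ F (‖x‖ ^ 2)` involves only the second and third derivatives
of `F`, since the third derivative of `‖x‖ ^ 2` vanishes. -/
lemma norm_iteratedFDeriv_three_le_of_eq_comp_norm_sq {E : Type*} [NormedAddCommGroup E]
    [InnerProductSpace ℝ E] {F F₁ F₂ F₃ : ℝ → ℝ} {I : Set ℝ} (hI : IsOpen I)
    (h₁ : ∀ t ∈ I, HasDerivAt F (F₁ t) t) (h₂ : ∀ t ∈ I, HasDerivAt F₁ (F₂ t) t)
    (h₃ : ∀ t ∈ I, HasDerivAt F₂ (F₃ t) t) {f : E → ℝ} (hf : ∀ y, f y = F (‖y‖ ^ 2)) {x : E}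
    (hx : ‖x‖ ^ 2 ∈ I) :
    ‖iteratedFDeriv ℝ 3 f x‖
      ≤ 12 * |F₂ (‖x‖ ^ 2)| * ‖x‖ + 8 * |F₃ (‖x‖ ^ 2)| * ‖x‖ ^ 3 := by
  obtain rfl : f = fun y => F (‖y‖ ^ 2) := funext hf
  set A : E →L[ℝ] E →L[ℝ] ℝ := innerSL ℝ
  set R := ContinuousLinearMap.smulRightL ℝ E (E →L[ℝ] ℝ)
  have hAx : ∀ y : E, ‖A y‖ = ‖y‖ := fun y => innerSL_apply_norm ℝ y
  set U : Set E := {y | ‖y‖ ^ 2 ∈ I}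
  have hUo : IsOpen U := hI.preimage (by fun_prop)
  have hq : ∀ y : E, HasFDerivAt (fun y : E => ‖y‖ ^ 2) ((2 : ℝ) • A y) y := fun y => by
    have := (hasStrictFDerivAt_norm_sq y).hasFDerivAt
    rwa [two_nsmul, ← two_smul ℝ] at this
  have hcomp : ∀ {G G' : ℝ → ℝ}, (∀ t ∈ I, HasDerivAt G (G' t) t) → ∀ y ∈ U,
      HasFDerivAt (fun y : E => G (‖y‖ ^ 2)) (G' (‖y‖ ^ 2) • (2 : ℝ) • A y) y :=
    fun h y hy => (h _ hy).comp_hasFDerivAt y (hq y)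
  have hd1 : ∀ y ∈ U, fderiv ℝ (fun y : E => F (‖y‖ ^ 2)) y = F₁ (‖y‖ ^ 2) • (2 : ℝ) • A y :=
    fun y hy => (hcomp h₁ y hy).fderiv
  have hd2 : ∀ y ∈ U, fderiv ℝ (fderiv ℝ (fun y : E => F (‖y‖ ^ 2))) y
      = F₁ (‖y‖ ^ 2) • (2 : ℝ) • A + (F₂ (‖y‖ ^ 2) * 4) • R (A y) (A y) := fun y hy => by
    rw [Filter.EventuallyEq.fderiv_eq (Filter.eventually_of_mem (hUo.mem_nhds hy) hd1),
      HasFDerivAt.fderiv (f := fun y => F₁ (‖y‖ ^ 2) • (2 : ℝ) • A y)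
        ((hcomp h₂ y hy).smul (A.hasFDerivAt.const_smul (2 : ℝ)))]
    ext u v
    simp [R]
    ring
  have hRd : HasFDerivAt (fun y => R (A y) (A y)) (R.precompR E (A x) A + R.precompL E A (A x)) x :=
    R.hasFDerivAt_of_bilinear A.hasFDerivAt A.hasFDerivAt
  have hd3 : fderiv ℝ (fderiv ℝ (fderiv ℝ (fun y : E => F (‖y‖ ^ 2)))) x
      = (F₂ (‖x‖ ^ 2) • (2 : ℝ) • A x).smulRight ((2 : ℝ) • A)
        + ((F₂ (‖x‖ ^ 2) * 4) • (R.precompR E (A x) A + R.precompL E A (A x))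
          + ((4 : ℝ) • F₃ (‖x‖ ^ 2) • (2 : ℝ) • A x).smulRight (R (A x) (A x))) := by
    rw [Filter.EventuallyEq.fderiv_eq (Filter.eventually_of_mem (hUo.mem_nhds hx) hd2)]
    exact (((hcomp h₂ x hx).smul_const ((2 : ℝ) • A)).add
      (((hcomp h₃ x hx).mul_const 4).smul hRd)).fderiv
  have hRn : ‖R‖ ≤ 1 := ContinuousLinearMap.norm_smulRightL_le
  have hAn : ‖A‖ ≤ 1 := norm_innerSL_le ℝ
  have hR1 : ‖R.precompR E (A x) A‖ ≤ ‖x‖ := by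
    refine ((R.precompR E).le_opNorm₂ _ _).trans ?_
    rw [hAx]
    have := (R.norm_precompR_le E).trans hRn
    calc _ ≤ 1 * ‖x‖ * 1 := by gcongr
      _ = _ := by ring
  have hR2 : ‖R.precompL E A (A x)‖ ≤ ‖x‖ := by
    refine ((R.precompL E).le_opNorm₂ _ _).trans ?_
    rw [hAx]
    have := (R.norm_precompL_le E).trans hRn
    calc _ ≤ 1 * 1 * ‖x‖ := by gcongr
      _ = _ := by ring
  rw [norm_iteratedFDeriv_three, hd3]
  refine (norm_add_le _ _).trans ((add_le_add_right (norm_add_le _ _) _).trans ?_)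
  have e : ‖R (A x) (A x)‖ = ‖x‖ * ‖x‖ := by
    simp [R, ContinuousLinearMap.smulRightL, ContinuousLinearMap.norm_smulRight_apply, hAx]
  rw [ContinuousLinearMap.norm_smulRight_apply, ContinuousLinearMap.norm_smulRight_apply, e]
  simp only [norm_smul, hAx, Real.norm_eq_abs, abs_mul, Nat.abs_ofNat]
  have h4 : ‖R.precompR E (A x) A + R.precompL E A (A x)‖ ≤ ‖x‖ + ‖x‖ :=
    (norm_add_le _ _).trans (add_le_add hR1 hR2)
  calc _ ≤ |F₂ (‖x‖ ^ 2)| * (2 * ‖x‖) * (2 * 1) + (|F₂ (‖x‖ ^ 2)| * 4 * (‖x‖ + ‖x‖) +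
        4 * (|F₃ (‖x‖ ^ 2)| * (2 * ‖x‖)) * (‖x‖ * ‖x‖)) := by gcongr
    _ = _ := by ring

/-- The derivatives of `sin (log (log v))`. -/
lemma exists_derivs_sin_log_log : ∃ H₁ H₂ H₃ : ℝ → ℝ, ∀ v, Real.exp 1 < v →
    HasDerivAt (fun v => Real.sin (Real.log (Real.log v))) (H₁ v) v ∧
    HasDerivAt H₁ (H₂ v) v ∧ HasDerivAt H₂ (H₃ v) v ∧
    |H₁ v| ≤ 13 / v ∧ |H₂ v| ≤ 13 / v ∧ |H₃ v| ≤ 13 / v := by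
  let a : ℝ → ℝ := fun v => v⁻¹
  let b : ℝ → ℝ := fun v => (Real.log v)⁻¹
  let S : ℝ → ℝ := fun v => Real.sin (Real.log (Real.log v))
  let C : ℝ → ℝ := fun v => Real.cos (Real.log (Real.log v))
  refine ⟨fun v => C v * a v * b v,
    fun v => -S v * a v ^ 2 * b v ^ 2 - C v * a v ^ 2 * b v - C v * a v ^ 2 * b v ^ 2,
    fun v => 2 * C v * a v ^ 3 * b v + 3 * S v * a v ^ 3 * b v ^ 2 + 3 * C v * a v ^ 3 * b v ^ 2
      + C v * a v ^ 3 * b v ^ 3 + 3 * S v * a v ^ 3 * b v ^ 3, fun v hv => ?_⟩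
  have hv1 : 1 < v := (Real.one_lt_exp_iff.2 one_pos).trans hv
  have hv0 : 0 < v := by linarith
  have hl : 1 < Real.log v := (Real.lt_log_iff_exp_lt hv0).2 hv
  have hl0 : Real.log v ≠ 0 := by linarith
  have ha : HasDerivAt a (-a v ^ 2) v := by
    convert! hasDerivAt_inv hv0.ne' using 1
    simp [a]
  have hb : HasDerivAt b (-a v * b v ^ 2) v := by
    convert! (Real.hasDerivAt_log hv0.ne').inv hl0 using 1
    simp [a, b]; ring
  have hu : HasDerivAt (fun v => Real.log (Real.log v)) (a v * b v) v := by
    convert! (Real.hasDerivAt_log hv0.ne').log hl0 using 1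
  have hS : HasDerivAt S (C v * a v * b v) v := by
    convert! hu.sin using 1
    simp [C]; ring
  have hC : HasDerivAt C (-S v * a v * b v) v := by
    convert! hu.cos using 1
    simp [S]; ring
  have hSb : |S v| ≤ 1 := Real.abs_sin_le_one _
  have hCb : |C v| ≤ 1 := Real.abs_cos_le_one _
  have ha0 : 0 ≤ a v := by positivity
  have ha1 : a v ≤ 1 := inv_le_one_of_one_le₀ hv1.le
  have hb0 : 0 ≤ b v := by simp only [b]; positivity
  have hb1 : b v ≤ 1 := inv_le_one_of_one_le₀ hl.le
  have key : ∀ X, |X| ≤ 1 → ∀ m n : ℕ, |X * a v ^ (m + 1) * b v ^ n| ≤ a v := by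
    intro X hX m n
    rw [abs_mul, abs_mul, abs_pow, abs_pow, abs_of_nonneg ha0, abs_of_nonneg hb0, pow_succ]
    have := pow_le_one₀ (n := m) ha0 ha1
    have := pow_le_one₀ (n := n) hb0 hb1
    calc _ ≤ 1 * (1 * a v) * 1 := by gcongr
      _ = _ := by ring
  have e : 13 / v = 13 * a v := by simp [a]; ring
  rw [e]
  refine ⟨hS, ?_, ?_, ?_, ?_, ?_⟩
  · refine ((hC.mul ha).mul hb).congr_deriv ?_
    simp only [Pi.mul_apply]
    ring
  · refine ((((hS.neg.mul (ha.pow 2)).mul (hb.pow 2)).sub ((hC.mul (ha.pow 2)).mul hb)).sub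
      ((hC.mul (ha.pow 2)).mul (hb.pow 2))).congr_deriv ?_
    simp only [Pi.mul_apply, Pi.pow_apply, Pi.neg_apply]
    push_cast
    ring
  · have := key _ hCb 0 1
    simp only [zero_add, pow_one] at this
    linarith
  · have h1 := abs_le.1 (key _ hSb 1 2)
    have h2 := abs_le.1 (key _ hCb 1 1)
    have h3 := abs_le.1 (key _ hCb 1 2)
    norm_num at h1 h2 h3
    rw [abs_le]
    constructor <;> nlinarith
  · have h1 := abs_le.1 (key _ hCb 2 1)
    have h2 := abs_le.1 (key _ hSb 2 2)
    have h3 := abs_le.1 (key _ hCb 2 2)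
    have h4 := abs_le.1 (key _ hCb 2 3)
    have h5 := abs_le.1 (key _ hSb 2 3)
    norm_num at h1 h2 h3 h4 h5
    rw [abs_le]
    constructor <;> nlinarith

lemma integrableOn_inv_mul_log_pow :
    IntegrableOn (fun r : ℝ => (r * (Real.exp 1 - Real.log r) ^ 4)⁻¹) (Set.Ioc 0 1) := by
  -- an antiderivative, extended continuously to `0`
  let g : ℝ → ℝ := Function.update (fun r => ((Real.exp 1 - Real.log r) ^ 3)⁻¹ / 3) 0 0
  have he : 0 < Real.exp 1 := Real.exp_pos 1
  have hL : ∀ r : ℝ, 0 < r → r ≤ 1 → 0 < Real.exp 1 - Real.log r := fun r h0 h1 => by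
    have := Real.log_nonpos h0.le h1
    linarith
  have hg : ∀ r : ℝ, 0 < r → r ≤ 1 → HasDerivAt g (r * (Real.exp 1 - Real.log r) ^ 4)⁻¹ r := by
    intro r h0 h1
    have hp := hL r h0 h1
    have h := ((((Real.hasDerivAt_log h0.ne').const_sub (Real.exp 1)).pow 3).inv
      (pow_pos hp 3).ne').div_const 3
    refine (h.congr_of_eventuallyEq ?_).congr_deriv ?_
    · filter_upwards [isOpen_ne.mem_nhds h0.ne'] with y hy
      simp [g, Function.update_of_ne hy]
    · simp only [Pi.pow_apply]
      field_simp
      push_cast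
      ring
  refine intervalIntegral.integrableOn_deriv_of_nonneg (g := g) ?_
    (fun r hr => hg r hr.1 hr.2.le) (fun r hr => ?_)
  · intro r hr
    rcases hr.1.eq_or_lt with rfl | h0
    · refine ContinuousWithinAt.mono (t := Set.Ici 0) ?_ Set.Icc_subset_Ici_self
      rw [continuousWithinAt_update_same, Set.Ici_sdiff_left]
      have h := Filter.tendsto_atTop_add_const_left _ (Real.exp 1)
        (Filter.tendsto_neg_atBot_atTop.comp Real.tendsto_log_nhdsGT_zero)
      have h3 := ((Filter.tendsto_pow_atTop (three_ne_zero)).comp h).inv_tendsto_atTop.div_const 3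
      rw [zero_div] at h3
      refine h3.congr fun y => ?_
      simp [sub_eq_add_neg]
    · exact (hg r h0 hr.2).continuousAt.continuousWithinAt
  · have := hL r hr.1 hr.2.le
    have := hr.1
    positivity

/-- The derivatives of the profile `F` for which `w x = F (‖x‖ ^ 2)`. -/
lemma exists_derivs_w_profile : ∃ F₁ F₂ F₃ : ℝ → ℝ, ∀ s ∈ Set.Ioo (0 : ℝ) 1,
    HasDerivAt (fun s => s * Real.sin (Real.log (Real.log (Real.exp 1 - Real.log s / 2))))
      (F₁ s) s ∧
    HasDerivAt F₁ (F₂ s) s ∧ HasDerivAt F₂ (F₃ s) s ∧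
    |F₂ s| ≤ 13 / (Real.exp 1 - Real.log s / 2) * s⁻¹ ∧
    |F₃ s| ≤ 13 / (Real.exp 1 - Real.log s / 2) * s⁻¹ ^ 2 := by
  obtain ⟨H₁, H₂, H₃, hH⟩ := exists_derivs_sin_log_log
  let v : ℝ → ℝ := fun s => Real.exp 1 - Real.log s / 2
  refine ⟨fun s => Real.sin (Real.log (Real.log (v s))) - H₁ (v s) / 2,
    fun s => (-(H₁ (v s) / 2) + H₂ (v s) / 4) * s⁻¹,
    fun s => (H₁ (v s) / 2 - H₃ (v s) / 8) * s⁻¹ ^ 2, fun s hs => ?_⟩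
  have hs0 : s ≠ 0 := hs.1.ne'
  have hvs : Real.exp 1 < v s := by
    simp only [v]
    linarith [Real.log_neg hs.1 hs.2]
  have hvd : HasDerivAt v (-(s⁻¹ / 2)) s :=
    ((Real.hasDerivAt_log hs0).div_const 2).const_sub _
  obtain ⟨d₁, d₂, d₃, b₁, b₂, b₃⟩ := hH _ hvs
  refine ⟨?_, ?_, ?_, ?_, ?_⟩
  · refine ((hasDerivAt_id s).mul (d₁.comp s hvd)).congr_deriv ?_
    simp
    field_simp
    ring
  · refine ((d₁.comp s hvd).sub ((d₂.comp s hvd).div_const 2)).congr_deriv ?_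
    ring
  · refine ((((d₂.comp s hvd).div_const 2).neg.add ((d₃.comp s hvd).div_const 4)).mul
      (hasDerivAt_inv hs0)).congr_deriv ?_
    simp
    field_simp
    ring
  all_goals
    have hv0 : 0 < v s := (Real.exp_pos 1).trans hvs
    have hb : 0 < 13 / v s := by positivity
    have hs1 : 0 < s⁻¹ := inv_pos.2 hs.1
    rw [abs_le] at b₁ b₂ b₃
    simp only [abs_mul, abs_pow, abs_of_pos hs1]
    gcongr
    change _ ≤ 13 / v s
    rw [abs_le]
    constructor <;> linarith

lemma norm_iteratedFDeriv_three_w_le {x : EuclideanSpace ℝ (Fin 4)} (hx0 : 0 < ‖x‖)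
    (hx1 : ‖x‖ < 1) :
    ‖iteratedFDeriv ℝ 3 w x‖ ≤ 260 / (‖x‖ * (Real.exp 1 - Real.log ‖x‖)) := by
  obtain ⟨F₁, F₂, F₃, hF⟩ := exists_derivs_w_profile
  have hv : ∀ y : EuclideanSpace ℝ (Fin 4),
      Real.exp 1 - Real.log (‖y‖ ^ 2) / 2 = Real.exp 1 - Real.log ‖y‖ := fun y => by
    rw [Real.log_pow]
    push_cast
    ring
  have hs : ‖x‖ ^ 2 ∈ Set.Ioo (0 : ℝ) 1 := ⟨by positivity, by nlinarith⟩
  have hw : ∀ y, w y =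
      (fun s => s * Real.sin (Real.log (Real.log (Real.exp 1 - Real.log s / 2)))) (‖y‖ ^ 2) :=
    fun y => by simp only [w, φ, hv]
  refine (norm_iteratedFDeriv_three_le_of_eq_comp_norm_sq isOpen_Ioo (fun s hs => (hF s hs).1)
    (fun s hs => (hF s hs).2.1) (fun s hs => (hF s hs).2.2.1) hw hs).trans ?_
  obtain ⟨-, -, -, b₂, b₃⟩ := hF _ hs
  rw [hv] at b₂ b₃
  have hlog := Real.log_neg hx0 hx1
  have hL : 0 < Real.exp 1 - Real.log ‖x‖ := by linarith [Real.exp_pos 1]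
  calc _ ≤ 12 * (13 / (Real.exp 1 - Real.log ‖x‖) * (‖x‖ ^ 2)⁻¹) * ‖x‖ +
        8 * (13 / (Real.exp 1 - Real.log ‖x‖) * ((‖x‖ ^ 2)⁻¹) ^ 2) * ‖x‖ ^ 3 := by gcongr
    _ = _ := by
      field_simp
      norm_num

/-- The third derivatives of `w` are in `L⁴` of the (punctured) unit ball. -/
theorem stmt_14 :
    IntegrableOn (fun x => ‖iteratedFDeriv ℝ 3 w x‖ ^ 4)
      (ball (0 : EuclideanSpace ℝ (Fin 4)) 1 \ {0}) volume := by
  have hmaj : IntegrableOn (fun x : EuclideanSpace ℝ (Fin 4) =>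
      (260 / (‖x‖ * (Real.exp 1 - Real.log ‖x‖))) ^ 4) (ball 0 1) volume := by
    refine (integrableOn_fun_norm_addHaar volume
      (f := fun r : ℝ => (260 / (r * (Real.exp 1 - Real.log r))) ^ 4)).2 ?_
    refine IntegrableOn.congr_fun ((integrableOn_inv_mul_log_pow.mono_set
      Set.Ioo_subset_Ioc_self).const_mul (260 ^ 4)) (fun r hr => ?_) measurableSet_Ioo
    have hr0 : r ≠ 0 := hr.1.ne'
    simp only [finrank_euclideanSpace, Fintype.card_fin, smul_eq_mul, div_pow, mul_pow]
    field_simp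
  refine (hmaj.mono_set Set.sdiff_subset).mono' ?_ ?_
  · exact ((measurable_norm_iteratedFDeriv_three w).pow_const 4).aestronglyMeasurable
  · refine ae_restrict_of_forall_mem (measurableSet_ball.diff (measurableSet_singleton 0))
      fun x hx => ?_
    rw [norm_pow, norm_norm]
    gcongr
    exact norm_iteratedFDeriv_three_w_le (norm_pos_iff.2 hx.2) (mem_ball_zero_iff.1 hx.1)
end

section
/- Let (μ_k) be a sequence of Borel measures on a metric space X with μ_k(X) ≤ M for all k, and let ε > 0. Then the set A = { x ∈ X : ∀ r > 0, ∃ K, ∀ k ≥ K, μ_k(ball x r) > ε } is finite and has at most ⌊M/ε⌋ elements. -/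
open MeasureTheory Metric

open Filter Topology in
/-- Around the points of a finite set in a metric space, balls of a common small radius
are pairwise disjoint. -/
theorem Finset.exists_pairwiseDisjoint_ball {X : Type*} [MetricSpace X] (t : Finset X) :
    ∃ r > 0, (t : Set X).PairwiseDisjoint (fun x => ball x r) := by
  have h : ∀ᶠ r : ℝ in 𝓝[>] 0, ∀ x ∈ t, ∀ y ∈ t, x ≠ y → Disjoint (ball x r) (ball y r) := by
    refine (Filter.eventually_all_finset t).2 fun x _ =>
      (Filter.eventually_all_finset t).2 fun y _ => ?_
    by_cases hxy : x = y
    · simp [hxy]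
    filter_upwards [Ioo_mem_nhdsGT (half_pos (dist_pos.2 hxy))] with r hr _
    exact ball_disjoint_ball (by linarith [hr.2])
  obtain ⟨r, hr, hr0⟩ := (h.and self_mem_nhdsWithin).exists
  exact ⟨r, hr0, fun x hx y hy hxy => hr x hx y hy hxy⟩

/-- A finite set of concentration points of measures of total mass at most `M`
has at most `⌊M / ε⌋` elements. -/
theorem card_le_floor_of_eventually_lt_measure_ball {X : Type*} [MetricSpace X]
    [MeasurableSpace X] [BorelSpace X] {μ : ℕ → Measure X} {M ε : ℝ} (hε : 0 < ε)
    (hM : ∀ k, μ k Set.univ ≤ ENNReal.ofReal M) (t : Finset X)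
    (ht : ∀ x ∈ t, ∀ r > 0, ∃ K, ∀ k ≥ K, ENNReal.ofReal ε < μ k (ball x r)) :
    t.card ≤ ⌊M / ε⌋₊ := by
  rcases t.eq_empty_or_nonempty with rfl | hne
  · simp
  have hcard : (0 : ℝ) < t.card := by exact_mod_cast hne.card_pos
  obtain ⟨r, hr, hdisj⟩ := t.exists_pairwiseDisjoint_ball
  have hev : ∀ᶠ k in Filter.atTop, ∀ x ∈ t, ENNReal.ofReal ε < μ k (ball x r) :=
    (Filter.eventually_all_finset t).2 fun x hx => Filter.eventually_atTop.2 (ht x hx r hr)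
  obtain ⟨k, hk⟩ := hev.exists
  have hsum : ENNReal.ofReal (t.card * ε) ≤ ENNReal.ofReal M := calc
    ENNReal.ofReal (t.card * ε) = ∑ _x ∈ t, ENNReal.ofReal ε := by
      simp [ENNReal.ofReal_mul]
    _ ≤ ∑ x ∈ t, μ k (ball x r) := Finset.sum_le_sum fun x hx => (hk x hx).le
    _ = μ k (⋃ x ∈ t, ball x r) :=
      (measure_biUnion_finset hdisj fun _ _ => measurableSet_ball).symm
    _ ≤ μ k Set.univ := measure_mono (Set.subset_univ _)
    _ ≤ ENNReal.ofReal M := hM k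
  rw [Nat.le_floor_iff' hne.card_pos.ne', le_div_iff₀ hε]
  exact (ENNReal.ofReal_le_ofReal_iff'.1 hsum).resolve_right (mul_pos hcard hε).not_ge

/-- The 'bad points' argument of Section 3.1: if `μ_k(X) ≤ M` for all `k`, the set of
points at which the measures `μ_k` eventually concentrate more than `ε > 0` mass on
every ball is finite, with at most `⌊M/ε⌋` elements. -/
theorem stmt_19 {X : Type*} [MetricSpace X] [MeasurableSpace X] [BorelSpace X]
    (μ : ℕ → Measure X) (M ε : ℝ) (hε : 0 < ε)
    (hM : ∀ k, μ k Set.univ ≤ ENNReal.ofReal M) :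
    {x : X | ∀ r > 0, ∃ K, ∀ k ≥ K, ENNReal.ofReal ε < μ k (ball x r)}.Finite ∧
    Nat.card {x : X | ∀ r > 0, ∃ K, ∀ k ≥ K, ENNReal.ofReal ε < μ k (ball x r)} ≤
      ⌊M / ε⌋₊ := by
  have hcard := card_le_floor_of_eventually_lt_measure_ball hε hM
  have hfin : {x : X | ∀ r > 0, ∃ K, ∀ k ≥ K,
      ENNReal.ofReal ε < μ k (ball x r)}.Finite := by
    by_contra hinf
    obtain ⟨t, hts, ht⟩ := Set.Infinite.exists_subset_card_eq hinf (⌊M / ε⌋₊ + 1)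
    have := hcard t fun x hx => hts hx
    omega
  refine ⟨hfin, ?_⟩
  rw [Nat.card_coe_set_eq, Set.ncard_eq_toFinset_card _ hfin]
  exact hcard _ fun x hx => hfin.mem_toFinset.1 hx
end
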